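/- arXiv:2207.03362 — 4 statements merged into one kernel-verified Lean document; each statement's English description precedes it below -/
import Mathlib

section
/- Let A = B *_D C be an amalgamated free product, where B and C are subgroups of A with B ∩ C = D. Suppose D is separable in A, and let U ⊆ B and V ⊆ C be arbitrary subsets. If the product UD is separable in A, then the product UC is separable in A; likewise, if the product DV is separable in A, then the product BV is separable in A. -/
open Pointwise

universe u

/-- A subset `Z` of a group `G` is separable (closed in the profinite topology on `G`):
for every `g ∉ Z` there is a finite index normal subgroup `N` of `G` with `g ∉ ZN`. -/
def SepSubset {G : Type*} [Group G] (Z : Set G) : Prop :=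
  ∀ g ∉ Z, ∃ N : Subgroup G, N.Normal ∧ N.FiniteIndex ∧ g ∉ Z * (N : Set G)

/-- A group `A` with subgroups `B`, `C` is the amalgamated free product `B *_{B ⊓ C} C`:
`A` is generated by `B` and `C`, and `A` (with the inclusions of `B` and `C`) satisfies the
universal property of the pushout of `B ↩ B ⊓ C ↪ C`; equivalently, the canonical
homomorphism from that pushout to `A` is an isomorphism. -/
def IsAmalgam {A : Type u} [Group A] (B C : Subgroup A) : Prop :=
  B ⊔ C = ⊤ ∧
  ∀ (H : Type u) [Group H] (f : B →* H) (g : C →* H),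
    (∀ (x : A) (hxB : x ∈ B) (hxC : x ∈ C), f ⟨x, hxB⟩ = g ⟨x, hxC⟩) →
    ∃! h : A →* H, h.comp B.subtype = f ∧ h.comp C.subtype = g

/-- Two finite free actions of a finite group on sets of the same cardinality are isomorphic, by an
isomorphism extending any given one between invariant subsets. -/
theorem exists_equiv_of_free_actions {R X₁ X₂ : Type u} [Group R] [Finite R] [Finite X₁]
    [Finite X₂] (ρ₁ : R →* Equiv.Perm X₁) (ρ₂ : R →* Equiv.Perm X₂)
    (hfree₁ : ∀ r x, ρ₁ r x = x → r = 1) (hfree₂ : ∀ r x, ρ₂ r x = x → r = 1)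
    (hcard : Nat.card X₁ = Nat.card X₂) {Y : Type u} (ρ : R →* Equiv.Perm Y)
    (f₁ : Y → X₁) (f₂ : Y → X₂) (hf₁ : Function.Injective f₁) (hf₂ : Function.Injective f₂)
    (hρ₁ : ∀ r y, f₁ (ρ r y) = ρ₁ r (f₁ y)) (hρ₂ : ∀ r y, f₂ (ρ r y) = ρ₂ r (f₂ y)) :
    ∃ e : X₁ ≃ X₂, (∀ r x, e (ρ₁ r x) = ρ₂ r (e x)) ∧ ∀ y, e (f₁ y) = f₂ y := by
  induction hn : Nat.card X₁ - Nat.card Y using Nat.strong_induction_on generalizing Y with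
  | _ n ih =>
  have : Finite Y := Finite.of_injective f₁ hf₁
  by_cases hs : Function.Surjective f₁
  · have hb₁ : Function.Bijective f₁ := ⟨hf₁, hs⟩
    have hb₂ : Function.Bijective f₂ := by
      refine (Nat.bijective_iff_injective_and_card f₂).2 ⟨hf₂, ?_⟩
      rw [← hcard, Nat.card_eq_of_bijective f₁ hb₁]
    have he (y : Y) : ((Equiv.ofBijective f₁ hb₁).symm.trans (Equiv.ofBijective f₂ hb₂)) (f₁ y)
        = f₂ y := by
      rw [Equiv.trans_apply, Equiv.ofBijective_symm_apply_apply, Equiv.ofBijective_apply]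
    refine ⟨_, fun r x => ?_, he⟩
    obtain ⟨y, rfl⟩ := hs x
    rw [← hρ₁, he, he, hρ₂]
  · have hs₂ : ¬ Function.Surjective f₂ := fun h₂ => hs
      ((Nat.bijective_iff_injective_and_card f₁).2
        ⟨hf₁, by rw [hcard, Nat.card_eq_of_bijective f₂ ⟨hf₂, h₂⟩]⟩).2
    simp only [Function.Surjective, not_forall, not_exists] at hs hs₂
    obtain ⟨x₁, hx₁⟩ := hs
    obtain ⟨x₂, hx₂⟩ := hs₂
    have inj {X : Type u} {σ : R →* Equiv.Perm X} (hfree : ∀ r x, σ r x = x → r = 1)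
        {f : Y → X} (hf : Function.Injective f) (hσ : ∀ r y, f (ρ r y) = σ r (f y))
        {x : X} (hx : ∀ y, f y ≠ x) :
        Function.Injective (Sum.elim f fun r => σ r x) := by
      refine hf.sumElim (fun r s hrs => ?_) fun y r hy => hx (ρ r⁻¹ y) ?_
      · have : σ (s⁻¹ * r) x = x := by
          simp only [map_mul, map_inv, Equiv.Perm.mul_apply] at hrs ⊢
          simp [hrs]
        exact (inv_mul_eq_one.1 (hfree _ _ this)).symm
      · rw [hσ, hy]
        simp
    have hi₁ := inj hfree₁ hf₁ hρ₁ hx₁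
    have hi₂ := inj hfree₂ hf₂ hρ₂ hx₂
    obtain ⟨e, he, hef⟩ := ih (Nat.card X₁ - Nat.card (Y ⊕ R)) (by
        have h₁ := Nat.card_le_card_of_injective _ hi₁
        have h₂ : 0 < Nat.card R := Nat.card_pos
        rw [Nat.card_sum] at h₁ ⊢
        omega)
      ((Equiv.Perm.sumCongrHom Y R).comp (ρ.prod (MulAction.toPermHom R R)))
      _ _ hi₁ hi₂ (by rintro r (y | s) <;> simp [hρ₁])
      (by rintro r (y | s) <;> simp [hρ₂]) rfl
    exact ⟨e, he, fun y => hef (Sum.inl y)⟩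

/-- The saturation of a subset `Y` of `Γ` under left multiplication by the image of `θ`. -/
def leftSaturation {P Γ : Type*} [Group P] [Group Γ] (θ : P →* Γ) (Y : Set Γ) : Set Γ :=
  {x | ∃ p, ∃ y ∈ Y, θ p * y = x}

theorem subset_leftSaturation {P Γ : Type*} [Group P] [Group Γ] (θ : P →* Γ) (Y : Set Γ) :
    Y ⊆ leftSaturation θ Y :=
  fun y hy => ⟨1, y, hy, by simp⟩

theorem mul_mem_leftSaturation {P Γ : Type*} [Group P] [Group Γ] (θ : P →* Γ) {Y : Set Γ}
    (p : P) {x : Γ} (hx : x ∈ leftSaturation θ Y) : θ p * x ∈ leftSaturation θ Y := by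
  obtain ⟨q, y, hy, rfl⟩ := hx
  exact ⟨p * q, y, hy, by simp [mul_assoc]⟩

theorem finite_leftSaturation {P Γ : Type*} [Group P] [Group Γ] [Finite P] (θ : P →* Γ)
    {Y : Set Γ} (hY : Y.Finite) : (leftSaturation θ Y).Finite := by
  refine ((Set.finite_univ (α := P)).image2 (fun p y => θ p * y) hY).subset ?_
  rintro _ ⟨p, y, hy, rfl⟩
  exact ⟨p, trivial, y, hy, rfl⟩

theorem leftSaturation_comp_subset {R P Γ : Type*} [Group R] [Group P] [Group Γ] (φ : R →* P)
    (θ : P →* Γ) (Y : Set Γ) : leftSaturation (θ.comp φ) Y ⊆ leftSaturation θ Y := by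
  rintro _ ⟨r, y, hy, rfl⟩
  exact ⟨φ r, y, hy, rfl⟩

/-- The action of `P` on a saturated set by left multiplication. -/
def leftSaturationPerm {P Γ : Type*} [Group P] [Group Γ] (θ : P →* Γ) (Y : Set Γ) :
    P →* Equiv.Perm (leftSaturation θ Y) :=
  letI : MulAction P (leftSaturation θ Y) :=
    { smul p x := ⟨θ p * x, mul_mem_leftSaturation θ p x.2⟩
      one_smul x := Subtype.ext (by change θ 1 * (x : Γ) = x; simp)
      mul_smul p q x := Subtype.ext (by
        change θ (p * q) * (x : Γ) = θ p * (θ q * x); simp [mul_assoc]) }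
  MulAction.toPermHom P (leftSaturation θ Y)

@[simp]
theorem coe_leftSaturationPerm {P Γ : Type*} [Group P] [Group Γ] (θ : P →* Γ) (Y : Set Γ) (p : P)
    (x : leftSaturation θ Y) : (leftSaturationPerm θ Y p x : Γ) = θ p * x :=
  rfl

theorem eq_one_of_leftSaturationPerm {P Γ : Type*} [Group P] [Group Γ] {θ : P →* Γ}
    (hθ : Function.Injective θ) {Y : Set Γ} (p : P) (x : leftSaturation θ Y)
    (h : leftSaturationPerm θ Y p x = x) : p = 1 := by
  have h' := congrArg Subtype.val h
  rw [coe_leftSaturationPerm, mul_eq_right, ← map_one θ] at h'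
  exact hθ h'

/-- Left multiplications by two finite subgroups can be realized simultaneously on a finite set,
as far as a given finite subset `Y` of the ambient group is concerned. -/
theorem exists_finite_perm_model {R P Q Γ : Type u} [Group R] [Group P] [Group Q] [Group Γ]
    [Finite R] [Finite P] [Finite Q] (φ : R →* P) (ψ : R →* Q) (α : P →* Γ) (β : Q →* Γ)
    (hcomp : α.comp φ = β.comp ψ) (hφ : Function.Injective φ) (hψ : Function.Injective ψ)
    (hα : Function.Injective α) (hβ : Function.Injective β) {Y : Set Γ} (hY : Y.Finite)
    (hne : Y.Nonempty) :
    ∃ (X : Type u) (_ : Finite X) (a : P →* Equiv.Perm X) (b : Q →* Equiv.Perm X) (j : Γ → X),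
      a.comp φ = b.comp ψ ∧ Set.InjOn j Y ∧
      (∀ p, ∀ y ∈ Y, α p * y ∈ Y → a p (j y) = j (α p * y)) ∧
      ∀ q, ∀ y ∈ Y, β q * y ∈ Y → b q (j y) = j (β q * y) := by
  classical
  obtain ⟨y₀, hy₀⟩ := hne
  have : Finite (leftSaturation α Y) := finite_leftSaturation α hY
  have : Finite (leftSaturation β Y) := finite_leftSaturation β hY
  let X := leftSaturation α Y × leftSaturation β Y
  let s₀ : leftSaturation α Y := ⟨y₀, subset_leftSaturation α Y hy₀⟩
  let t₀ : leftSaturation β Y := ⟨y₀, subset_leftSaturation β Y hy₀⟩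
  let a : P →* Equiv.Perm X :=
    MonoidHom.mk' (fun p => (leftSaturationPerm α Y p).prodCongr (Equiv.refl _))
      fun p q => by ext x <;> simp
  let b : Q →* Equiv.Perm X :=
    MonoidHom.mk' (fun q => (Equiv.refl _).prodCongr (leftSaturationPerm β Y q))
      fun p q => by ext x <;> simp
  let Z := leftSaturation (α.comp φ) Y
  have hYZ : Y ⊆ Z := subset_leftSaturation _ Y
  have hZα : Z ⊆ leftSaturation α Y := leftSaturation_comp_subset φ α Y
  have hZβ : Z ⊆ leftSaturation β Y := by
    have := leftSaturation_comp_subset ψ β Y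
    rwa [← hcomp] at this
  have hcomp' (r : R) : α (φ r) = β (ψ r) := DFunLike.congr_fun hcomp r
  let f₁ : Z → X := fun z => (⟨z, hZα z.2⟩, t₀)
  let f₂ : Z → X := fun z => (s₀, ⟨z, hZβ z.2⟩)
  obtain ⟨e, he, hef⟩ := exists_equiv_of_free_actions (a.comp φ) (b.comp ψ)
    (fun r x h => hφ (by
      rw [map_one]; exact eq_one_of_leftSaturationPerm hα _ x.1 (congrArg Prod.fst h)))
    (fun r x h => hψ (by
      rw [map_one]; exact eq_one_of_leftSaturationPerm hβ _ x.2 (congrArg Prod.snd h)))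
    rfl (leftSaturationPerm (α.comp φ) Y) f₁ f₂
    (fun z w h => Subtype.ext (congrArg (fun x : X => (x.1 : Γ)) h))
    (fun z w h => Subtype.ext (congrArg (fun x : X => (x.2 : Γ)) h))
    (fun r z => Prod.ext (Subtype.ext rfl) rfl)
    (fun r z => Prod.ext rfl (Subtype.ext (by
      change α (φ r) * (z : Γ) = β (ψ r) * z
      rw [hcomp'])))
  let j : Γ → X := fun x => if h : x ∈ Z then f₁ ⟨x, h⟩ else (s₀, t₀)
  have hj {x : Γ} (h : x ∈ Y) : j x = f₁ ⟨x, hYZ h⟩ := dif_pos (hYZ h)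
  refine ⟨X, inferInstance, a, (MulAut.conj e⁻¹).toMonoidHom.comp b, j, ?_, ?_, ?_, ?_⟩
  · ext1 r
    ext1 x
    have := he r x
    simp only [MonoidHom.comp_apply] at this
    simp [← this]
  · intro x hx y hy hxy
    rw [hj hx, hj hy] at hxy
    exact congrArg (fun x : X => (x.1 : Γ)) hxy
  · intro p y hy hpy
    rw [hj hy, hj hpy]
    exact Prod.ext (Subtype.ext rfl) rfl
  · intro q y hy hqy
    rw [hj hy, hj hqy]
    suffices b q (e (f₁ ⟨y, hYZ hy⟩)) = e (f₁ ⟨β q * y, hYZ hqy⟩) by simp [this]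
    rw [hef, hef]
    exact Prod.ext rfl (Subtype.ext rfl)

section Amalgam

open Monoid Monoid.PushoutI

/-- Every element of an amalgam only involves finitely many elementary left translations. -/
theorem Monoid.PushoutI.exists_finite_translation_model {ι : Type*} [Nonempty ι] {H : Type*}
    {G : ι → Type*} [Group H] [∀ i, Group (G i)] {φ : ∀ i, H →* G i} (g : PushoutI φ) :
    ∀ x : PushoutI φ, ∃ T : Set (PushoutI φ), T.Finite ∧ x ∈ T ∧ g * x ∈ T ∧
      ∀ (X : Type u) (Φ : PushoutI φ →* Equiv.Perm X) (j : PushoutI φ → X),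
        (∀ i (p : G i), ∀ y ∈ T, of i p * y ∈ T → Φ (of i p) (j y) = j (of i p * y)) →
        Φ g (j x) = j (g * x) := by
  induction g using PushoutI.induction_on with
  | of i p =>
    exact fun x => ⟨{x, of i p * x}, by simp, by simp, by simp,
      fun X Φ j h => h i p x (by simp) (by simp)⟩
  | base r =>
    obtain ⟨i⟩ := ‹Nonempty ι›
    rw [← of_apply_eq_base φ i]
    exact fun x => ⟨{x, of i (φ i r) * x}, by simp, by simp, by simp,
      fun X Φ j h => h i _ x (by simp) (by simp)⟩
  | mul g₁ g₂ ih₁ ih₂ =>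
    intro x
    obtain ⟨T₂, hT₂, hx₂, -, h₂⟩ := ih₂ x
    obtain ⟨T₁, hT₁, -, hx₁, h₁⟩ := ih₁ (g₂ * x)
    refine ⟨T₁ ∪ T₂, hT₁.union hT₂, Or.inr hx₂, Or.inl (by rwa [mul_assoc]), fun X Φ j h => ?_⟩
    rw [map_mul, Equiv.Perm.mul_apply,
      h₂ X Φ j fun i p y hy hpy => h i p y (Or.inr hy) (Or.inr hpy),
      h₁ X Φ j fun i p y hy hpy => h i p y (Or.inl hy) (Or.inl hpy), mul_assoc]

/-- An amalgam of two finite groups is residually finite. -/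
theorem Monoid.PushoutI.residuallyFinite {H : Type u} {G : Bool → Type u} [Group H]
    [∀ i, Group (G i)] [Finite H] [∀ i, Finite (G i)] {φ : ∀ i, H →* G i}
    (hφ : ∀ i, Function.Injective (φ i)) : Group.ResiduallyFinite (PushoutI φ) := by
  refine Group.residuallyFinite_of_forall_exists_finite_monoidHom.{u} fun g hg => ?_
  obtain ⟨T, hT, h1, hgT, hmodel⟩ := exists_finite_translation_model g 1
  obtain ⟨X, _, a, b, j, hab, hj, ha, hb⟩ := exists_finite_perm_model (φ true) (φ false)
    (of (φ := φ) true) (of false) ((of_comp_eq_base true).trans (of_comp_eq_base false).symm)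
    (hφ _) (hφ _) (of_injective hφ _) (of_injective hφ _) hT ⟨1, h1⟩
  let f : ∀ i, G i →* Equiv.Perm X := fun i => Bool.rec b a i
  let Φ : PushoutI φ →* Equiv.Perm X :=
    lift f (a.comp (φ true)) (by rintro (_ | _); exacts [hab.symm, rfl])
  refine ⟨Equiv.Perm X, inferInstance, inferInstance, Φ, fun h => hg ?_⟩
  have := hmodel X Φ j (by
    rintro (_ | _) p y hy hpy
    · simpa [Φ, f] using hb p y hy hpy
    · simpa [Φ, f] using ha p y hy hpy)
  rw [h, mul_one, Equiv.Perm.one_apply] at this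
  exact (hj h1 (by simpa using hgT) this).symm

/-- Products of nonempty reduced words in an amalgam, whose first letter lies in the factor `i`
and whose last letter lies in the factor `j`. -/
inductive IsReducedProd {ι H : Type*} {G : ι → Type*} [Group H] [∀ i, Group (G i)]
    (φ : ∀ i, H →* G i) : ι → ι → PushoutI φ → Prop
  | singleton {i : ι} (x : G i) (hx : x ∉ (φ i).range) : IsReducedProd φ i i (of i x)
  | append {i j k l : ι} {x y : PushoutI φ} (hx : IsReducedProd φ i j x) (hjk : j ≠ k)
      (hy : IsReducedProd φ k l y) : IsReducedProd φ i l (x * y)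

theorem IsReducedProd.notMem_base_range {ι H : Type*} {G : ι → Type*} [Group H]
    [∀ i, Group (G i)] {φ : ∀ i, H →* G i} (hφ : ∀ i, Function.Injective (φ i)) {i j : ι}
    {x : PushoutI φ} (hx : IsReducedProd φ i j x) : x ∉ (base φ).range := by
  obtain ⟨w, hw, rfl⟩ : ∃ w : CoprodI.NeWord G i j, Reduced φ w.toWord ∧ ofCoprodI w.prod = x := by
    induction hx with
    | singleton x hx =>
      refine ⟨.singleton x fun h => hx (h ▸ one_mem _), ?_, by simp⟩
      simpa [Reduced, CoprodI.NeWord.toWord] using hx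
    | append _ hjk _ ihx ihy =>
      obtain ⟨v, hv, rfl⟩ := ihx
      obtain ⟨w, hw, rfl⟩ := ihy
      refine ⟨.append v hjk w, fun g hg => ?_, by simp⟩
      exact (List.mem_append.1 hg).elim (hv g) (hw g)
  intro h
  exact w.toList_ne_nil (congrArg CoprodI.Word.toList (hw.eq_empty_of_mem_range hφ h))

theorem IsReducedProd.ne_mul {ι H : Type*} {G : ι → Type*} [Group H]
    [∀ i, Group (G i)] {φ : ∀ i, H →* G i} (hφ : ∀ i, Function.Injective (φ i)) {i j : ι}
    (hij : i ≠ j) {x : PushoutI φ} (hx : IsReducedProd φ i j x) (p : G j) (q : G i) :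
    x ≠ of j p * of i q := by
  rintro rfl
  have key {k : ι} {r : G k} (hr : r ∈ (φ k).range) : of (φ := φ) k r ∈ (base φ).range := by
    obtain ⟨s, rfl⟩ := hr
    exact ⟨s, (of_apply_eq_base φ k s).symm⟩
  by_cases hp : p ∈ (φ j).range <;> by_cases hq : q ∈ (φ i).range
  · exact hx.notMem_base_range hφ (mul_mem (key hp) (key hq))
  · have := hx.append hij.symm (.singleton q⁻¹ (by simpa using hq))
    exact this.notMem_base_range hφ (by simpa using key hp)
  · have := (IsReducedProd.singleton p⁻¹ (by simpa using hp)).append hij.symm hx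
    exact this.notMem_base_range hφ (by simpa using key hq)
  · have := ((IsReducedProd.singleton p⁻¹ (by simpa using hp)).append hij.symm hx).append hij.symm
      (.singleton q⁻¹ (by simpa using hq))
    exact this.notMem_base_range hφ (by simp)

/-- Nonempty products `c₁ * b₁ * ⋯ * cₙ * bₙ` with all `cₖ ∈ C`, `bₖ ∈ B` lying outside `Z`. -/
inductive IsAlternatingProd {A : Type*} [Group A] (B C : Subgroup A) (Z : Set A) : A → Prop
  | pair {c b : A} (hc : c ∈ C) (hcZ : c ∉ Z) (hb : b ∈ B) (hbZ : b ∉ Z) :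
      IsAlternatingProd B C Z (c * b)
  | cons {c b x : A} (hc : c ∈ C) (hcZ : c ∉ Z) (hb : b ∈ B) (hbZ : b ∉ Z)
      (hx : IsAlternatingProd B C Z x) : IsAlternatingProd B C Z (c * b * x)

theorem IsAlternatingProd.mono {A : Type*} [Group A] {B C : Subgroup A} {Z Z' : Set A}
    (hZ : Z ⊆ Z') {x : A} (hx : IsAlternatingProd B C Z' x) : IsAlternatingProd B C Z x := by
  induction hx with
  | pair hc hcZ hb hbZ => exact .pair hc (mt (@hZ _) hcZ) hb (mt (@hZ _) hbZ)
  | cons hc hcZ hb hbZ _ ih => exact .cons hc (mt (@hZ _) hcZ) hb (mt (@hZ _) hbZ) ih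

/-- In a group generated by `B` and `C`, an element outside `B * C` is an alternating product, up
to multiplication by an element of `B` on the left and an element of `C` on the right. -/
theorem exists_eq_mul_or_isAlternatingProd {A : Type*} [Group A] {B C : Subgroup A}
    (hBC : B ⊔ C = ⊤) (g : A) :
    ∃ b ∈ B, ∃ c ∈ C, g = b * c ∨
      ∃ x, IsAlternatingProd B C ((B ⊓ C : Subgroup A) : Set A) x ∧ g = b * x * c := by
  have step (y : A) (hy : y ∈ (B : Set A) ∪ C) {g : A} (hg : ∃ b ∈ B, ∃ c ∈ C, g = b * c ∨
      ∃ x, IsAlternatingProd B C ((B ⊓ C : Subgroup A) : Set A) x ∧ g = b * x * c) :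
      ∃ b ∈ B, ∃ c ∈ C, y * g = b * c ∨
        ∃ x, IsAlternatingProd B C ((B ⊓ C : Subgroup A) : Set A) x ∧ y * g = b * x * c := by
    obtain ⟨b, hb, c, hc, h⟩ := hg
    by_cases hyB : y ∈ B
    · refine ⟨y * b, mul_mem hyB hb, c, hc, h.imp ?_ ?_⟩
      · rintro rfl
        simp [mul_assoc]
      · rintro ⟨x, hx, rfl⟩
        exact ⟨x, hx, by simp [mul_assoc]⟩
    have hyC : y ∈ C := hy.resolve_left hyB
    have hyD : y ∉ B ⊓ C := fun hd => hyB hd.1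
    by_cases hbC : b ∈ C
    · rcases h with rfl | ⟨x, hx, rfl⟩
      · exact ⟨1, one_mem _, y * b * c, mul_mem (mul_mem hyC hbC) hc, Or.inl (by simp [mul_assoc])⟩
      cases hx with
      | @pair c₁ b₁ hc₁ _ hb₁ hb₁D =>
        have hmem : y * b * c₁ ∈ C := mul_mem (mul_mem hyC hbC) hc₁
        by_cases hB : y * b * c₁ ∈ B
        · exact ⟨y * b * c₁ * b₁, mul_mem hB hb₁, c, hc, Or.inl (by simp [mul_assoc])⟩
        · exact ⟨1, one_mem _, c, hc, Or.inr ⟨y * b * c₁ * b₁,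
            .pair hmem (fun hd => hB hd.1) hb₁ hb₁D, by simp [mul_assoc]⟩⟩
      | @cons c₁ b₁ x hc₁ _ hb₁ hb₁D hx =>
        have hmem : y * b * c₁ ∈ C := mul_mem (mul_mem hyC hbC) hc₁
        by_cases hB : y * b * c₁ ∈ B
        · exact ⟨y * b * c₁ * b₁, mul_mem hB hb₁, c, hc, Or.inr ⟨x, hx, by simp [mul_assoc]⟩⟩
        · exact ⟨1, one_mem _, c, hc, Or.inr ⟨y * b * c₁ * b₁ * x,
            .cons hmem (fun hd => hB hd.1) hb₁ hb₁D hx, by simp [mul_assoc]⟩⟩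
    · have hbD : b ∉ B ⊓ C := fun hd => hbC hd.2
      rcases h with rfl | ⟨x, hx, rfl⟩
      · exact ⟨1, one_mem _, c, hc, Or.inr ⟨y * b, .pair hyC hyD hb hbD, by simp [mul_assoc]⟩⟩
      · exact ⟨1, one_mem _, c, hc, Or.inr ⟨y * b * x, .cons hyC hyD hb hbD hx,
          by simp [mul_assoc]⟩⟩
  have hg : g ∈ Subgroup.closure ((B : Set A) ∪ C) := by
    rw [Subgroup.closure_union, Subgroup.closure_eq, Subgroup.closure_eq, hBC]
    trivial
  induction hg using Subgroup.closure_induction_left with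
  | one => exact ⟨1, one_mem _, 1, one_mem _, Or.inl (by simp)⟩
  | mul_left y hy g _ ih => exact step y hy ih
  | inv_mul_cancel y hy g _ ih => exact step y⁻¹ (by simpa using hy) ih

theorem SepSubset.exists_isAlternatingProd {A : Type*} [Group A] {B C : Subgroup A} {Z : Set A}
    (hZ : SepSubset Z) {x : A} (hx : IsAlternatingProd B C Z x) :
    ∃ N : Subgroup A, N.Normal ∧ N.FiniteIndex ∧ IsAlternatingProd B C (Z * (N : Set A)) x := by
  induction hx with
  | pair hc hcZ hb hbZ =>
    obtain ⟨N₁, _, _, h₁⟩ := hZ _ hcZ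
    obtain ⟨N₂, _, _, h₂⟩ := hZ _ hbZ
    exact ⟨N₁ ⊓ N₂, inferInstance, inferInstance,
      .pair hc (mt (@Set.mul_subset_mul_left _ _ _ _ _ inf_le_left _) h₁) hb
        (mt (@Set.mul_subset_mul_left _ _ _ _ _ inf_le_right _) h₂)⟩
  | cons hc hcZ hb hbZ _ ih =>
    obtain ⟨N₁, _, _, h₁⟩ := hZ _ hcZ
    obtain ⟨N₂, _, _, h₂⟩ := hZ _ hbZ
    obtain ⟨N₃, _, _, h₃⟩ := ih
    exact ⟨N₁ ⊓ N₂ ⊓ N₃, inferInstance, inferInstance,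
      .cons hc (mt (@Set.mul_subset_mul_left _ _ _ _ _ (inf_le_left.trans inf_le_left) _) h₁) hb
        (mt (@Set.mul_subset_mul_left _ _ _ _ _ (inf_le_left.trans inf_le_right) _) h₂)
        (h₃.mono (Set.mul_subset_mul_left inf_le_right))⟩

/-- Finite subsets of residually finite groups are separable. -/
theorem sepSubset_of_finite {G : Type*} [Group G] [Group.ResiduallyFinite G] {Z : Set G}
    (hZ : Z.Finite) : SepSubset Z := by
  intro g hg
  have : Finite Z := hZ
  choose N hN using fun z : Z => Group.exists_finiteIndexNormalSubgroup_notMem ((z : G)⁻¹ * g)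
    fun h => hg (by rw [← inv_mul_eq_one.1 h]; exact z.2)
  refine ⟨⨅ z, (N z).toSubgroup, Subgroup.normal_iInf_normal fun z => inferInstance,
    Subgroup.finiteIndex_iInf fun z => inferInstance, ?_⟩
  rintro ⟨z, hz, n, hn, rfl⟩
  refine hN ⟨z, hz⟩ ?_
  simpa using FiniteIndexNormalSubgroup.mem_toSubgroup_iff.1 (Subgroup.mem_iInf.1 hn ⟨z, hz⟩)

theorem SepSubset.exists_of_map_notMem {G G' : Type*} [Group G] [Group G'] (f : G →* G')
    {Z : Set G} (hZ : SepSubset (f '' Z)) {g : G} (hg : f g ∉ f '' Z) :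
    ∃ N : Subgroup G, N.Normal ∧ N.FiniteIndex ∧ g ∉ Z * (N : Set G) := by
  obtain ⟨N, _, _, h⟩ := hZ _ hg
  refine ⟨N.comap f, inferInstance,
    ((FiniteIndexNormalSubgroup.ofSubgroup N).comap f).isFiniteIndex', ?_⟩
  rintro ⟨z, hz, n, hn, rfl⟩
  exact h ⟨f z, ⟨z, hz, rfl⟩, f n, hn, by simp⟩

theorem SepSubset.inv {G : Type*} [Group G] {Z : Set G} (hZ : SepSubset Z) : SepSubset Z⁻¹ := by
  intro g hg
  obtain ⟨N, hN, _, h⟩ := hZ g⁻¹ (by simpa using hg)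
  refine ⟨N, hN, inferInstance, ?_⟩
  rintro ⟨z, hz, n, hn, rfl⟩
  exact h ⟨z⁻¹, hz, z * n⁻¹ * z⁻¹, hN.conj_mem _ (inv_mem hn) z, by simp [mul_assoc]⟩

theorem IsAmalgam.symm {A : Type u} [Group A] {B C : Subgroup A} (h : IsAmalgam B C) :
    IsAmalgam C B := by
  refine ⟨sup_comm B C ▸ h.1, fun H _ f g hfg => ?_⟩
  simpa only [and_comm] using h.2 H g f fun x hB hC => (hfg x hC hB).symm

/-- The images in `A ⧸ N` of the two factors. -/
def quotientFactor {A : Type*} [Group A] (B C N : Subgroup A) [N.Normal] (i : Bool) :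
    Subgroup (A ⧸ N) :=
  (bif i then B else C).map (QuotientGroup.mk' N)

/-- The inclusions of the image in `A ⧸ N` of `B ⊓ C` into the images of the two factors. -/
def quotientInclusion {A : Type*} [Group A] (B C N : Subgroup A) [N.Normal] (i : Bool) :
    (B ⊓ C).map (QuotientGroup.mk' N) →* quotientFactor B C N i :=
  Subgroup.inclusion (Subgroup.map_mono (by cases i; exacts [inf_le_right, inf_le_left]))

theorem quotientInclusion_injective {A : Type*} [Group A] (B C N : Subgroup A) [N.Normal]
    (i : Bool) : Function.Injective (quotientInclusion B C N i) :=
  Subgroup.inclusion_injective _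

/-- The projection of a factor onto its image in `A ⧸ N`. -/
def toQuotientFactor {A : Type*} [Group A] (B C N : Subgroup A) [N.Normal] (i : Bool) :
    (bif i then B else C : Subgroup A) →* quotientFactor B C N i :=
  (QuotientGroup.mk' N).subgroupMap _

theorem mem_mul_of_toQuotientFactor_mem_range {A : Type*} [Group A] {B C N : Subgroup A}
    [N.Normal] {i : Bool} {x : (bif i then B else C : Subgroup A)}
    (hx : toQuotientFactor B C N i x ∈ (quotientInclusion B C N i).range) :
    (x : A) ∈ ((B ⊓ C : Subgroup A) : Set A) * (N : Set A) := by
  obtain ⟨⟨_, d, hd, rfl⟩, h⟩ := hx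
  have h' : (d : A ⧸ N) = (x : A) := congrArg Subtype.val h
  exact ⟨d, hd, d⁻¹ * x, QuotientGroup.eq.1 h', by simp⟩

theorem IsAmalgam.exists_hom {A : Type u} [Group A] {B C : Subgroup A} (hAm : IsAmalgam B C)
    (N : Subgroup A) [N.Normal] :
    ∃ θ : A →* PushoutI (quotientInclusion B C N),
      (∀ b : B, θ b = of true (toQuotientFactor B C N true b)) ∧
      ∀ c : C, θ c = of false (toQuotientFactor B C N false c) := by
  obtain ⟨θ, ⟨h₁, h₂⟩, -⟩ := hAm.2 (PushoutI (quotientInclusion B C N))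
    ((of true).comp (toQuotientFactor B C N true)) ((of false).comp (toQuotientFactor B C N false))
    (fun x hB hC => by
      let d : (B ⊓ C).map (QuotientGroup.mk' N) := ⟨(x : A ⧸ N), x, ⟨hB, hC⟩, rfl⟩
      exact (of_apply_eq_base (quotientInclusion B C N) true d).trans
        (of_apply_eq_base (quotientInclusion B C N) false d).symm)
  exact ⟨θ, fun b => DFunLike.congr_fun h₁ b, fun c => DFunLike.congr_fun h₂ c⟩

theorem isReducedProd_of_isAlternatingProd {A : Type*} [Group A] {B C N : Subgroup A} [N.Normal]
    {θ : A →* PushoutI (quotientInclusion B C N)}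
    (hB : ∀ b : B, θ b = of true (toQuotientFactor B C N true b))
    (hC : ∀ c : C, θ c = of false (toQuotientFactor B C N false c)) {x : A}
    (hx : IsAlternatingProd B C (((B ⊓ C : Subgroup A) : Set A) * (N : Set A)) x) :
    IsReducedProd (quotientInclusion B C N) false true (θ x) := by
  have key {c b : A} (hc : c ∈ C) (hcZ : c ∉ ((B ⊓ C : Subgroup A) : Set A) * (N : Set A))
      (hb : b ∈ B) (hbZ : b ∉ ((B ⊓ C : Subgroup A) : Set A) * (N : Set A)) :
      IsReducedProd (quotientInclusion B C N) false true (θ (c * b)) := by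
    rw [map_mul, hB ⟨b, hb⟩, hC ⟨c, hc⟩]
    exact .append (.singleton _ (mt mem_mul_of_toQuotientFactor_mem_range hcZ)) (by simp)
      (.singleton _ (mt mem_mul_of_toQuotientFactor_mem_range hbZ))
  induction hx with
  | pair hc hcZ hb hbZ => exact key hc hcZ hb hbZ
  | cons hc hcZ hb hbZ _ ih =>
    rw [map_mul]
    exact .append (key hc hcZ hb hbZ) (by simp) ih

theorem IsAmalgam.sepSubset_mul {A : Type u} [Group A] {B C : Subgroup A} (hAm : IsAmalgam B C)
    (hD : SepSubset (((B ⊓ C : Subgroup A) : Set A))) {U : Set A} (hU : U ⊆ (B : Set A))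
    (hUD : SepSubset (U * ((B ⊓ C : Subgroup A) : Set A))) : SepSubset (U * (C : Set A)) := by
  have reduction (N : Subgroup A) [N.Normal] [N.FiniteIndex]
      {θ : A →* PushoutI (quotientInclusion B C N)}
      (hB : ∀ b : B, θ b = of true (toQuotientFactor B C N true b))
      (hC : ∀ c : C, θ c = of false (toQuotientFactor B C N false c)) {g : A}
      (hg : ∀ u, ∀ hu : u ∈ U, ∀ c : quotientFactor B C N false,
        θ g ≠ of true (toQuotientFactor B C N true ⟨u, hU hu⟩) * of false c) :
      ∃ K : Subgroup A, K.Normal ∧ K.FiniteIndex ∧ g ∉ U * (C : Set A) * (K : Set A) := by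
    have := PushoutI.residuallyFinite (quotientInclusion_injective B C N)
    have hfin : (θ '' (U * (C : Set A))).Finite := by
      refine (Set.finite_range fun x : quotientFactor B C N true × quotientFactor B C N false =>
        of (φ := quotientInclusion B C N) true x.1 * of false x.2).subset ?_
      rintro _ ⟨_, ⟨u, hu, c, hc, rfl⟩, rfl⟩
      exact ⟨(toQuotientFactor B C N true ⟨u, hU hu⟩, toQuotientFactor B C N false ⟨c, hc⟩),
        by simp only [map_mul, hB ⟨u, hU hu⟩, hC ⟨c, hc⟩]⟩
    refine (sepSubset_of_finite hfin).exists_of_map_notMem θ ?_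
    rintro ⟨_, ⟨u, hu, c, hc, rfl⟩, h⟩
    refine hg u hu (toQuotientFactor B C N false ⟨c, hc⟩) ?_
    rw [← h, map_mul, hB ⟨u, hU hu⟩, hC ⟨c, hc⟩]
  intro g hg
  obtain ⟨b, hb, c, hc, rfl | ⟨x, hx, rfl⟩⟩ := exists_eq_mul_or_isAlternatingProd hAm.1 g
  · have hbU : b ∉ U * ((B ⊓ C : Subgroup A) : Set A) := by
      rintro ⟨u, hu, d, hd, rfl⟩
      exact hg ⟨u, hu, d * c, mul_mem hd.2 hc, by simp [mul_assoc]⟩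
    obtain ⟨N, _, _, hN⟩ := hUD b hbU
    obtain ⟨θ, hB, hC⟩ := hAm.exists_hom N
    refine reduction N hB hC fun u hu c' h => hN ?_
    have hmem : of (φ := quotientInclusion B C N) true
        (toQuotientFactor B C N true (⟨u, hU hu⟩⁻¹ * ⟨b, hb⟩ : B)) ∈
          (base (quotientInclusion B C N)).range := by
      rw [← inf_of_range_eq_base_range (quotientInclusion_injective B C N)
        (i := true) (j := false) (by simp)]
      refine ⟨⟨_, rfl⟩, c' * (toQuotientFactor B C N false ⟨c, hc⟩)⁻¹, ?_⟩
      rw [map_mul, hB ⟨b, hb⟩, hC ⟨c, hc⟩] at h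
      rw [map_mul, map_inv, mul_inv_eq_iff_eq_mul]
      erw [map_mul, map_inv]
      rw [map_mul, map_inv, mul_assoc, h]
      simp
    obtain ⟨r, hr⟩ := hmem
    rw [← of_apply_eq_base _ true] at hr
    obtain ⟨d, hd, n, hn, h'⟩ := mem_mul_of_toQuotientFactor_mem_range
      ⟨r, of_injective (quotientInclusion_injective B C N) true hr⟩
    refine ⟨u * d, ⟨u, hu, d, hd, rfl⟩, n, hn, ?_⟩
    have h'' : d * n = u⁻¹ * b := h'
    simp [mul_assoc, h'']
  · obtain ⟨N, _, _, hN⟩ := hD.exists_isAlternatingProd hx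
    obtain ⟨θ, hB, hC⟩ := hAm.exists_hom N
    refine reduction N hB hC fun u hu c' h => ?_
    refine (isReducedProd_of_isAlternatingProd hB hC hN).ne_mul
      (quotientInclusion_injective B C N) (by simp)
      ((toQuotientFactor B C N true ⟨b, hb⟩)⁻¹ * toQuotientFactor B C N true ⟨u, hU hu⟩)
      (c' * (toQuotientFactor B C N false ⟨c, hc⟩)⁻¹) ?_
    rw [map_mul, map_mul, hB ⟨b, hb⟩, hC ⟨c, hc⟩] at h
    rw [map_mul, map_mul, map_inv, map_inv, mul_assoc, eq_inv_mul_iff_mul_eq, ← mul_assoc,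
      eq_mul_inv_iff_mul_eq]
    exact h

end Amalgam

/-- In an amalgamated free product `A = B *_D C` with `D = B ∩ C` separable in `A`:
if `U ⊆ B` and `UD` is separable in `A`, then `UC` is separable in `A`; likewise,
if `V ⊆ C` and `DV` is separable in `A`, then `BV` is separable in `A`. -/
theorem stmt_9 {A : Type u} [Group A] (B C : Subgroup A) (hAm : IsAmalgam B C)
    (hD : SepSubset (((B ⊓ C : Subgroup A) : Set A)))
    (U V : Set A) (hU : U ⊆ (B : Set A)) (hV : V ⊆ (C : Set A)) :
    (SepSubset (U * ((B ⊓ C : Subgroup A) : Set A)) → SepSubset (U * (C : Set A))) ∧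
    (SepSubset (((B ⊓ C : Subgroup A) : Set A) * V) → SepSubset ((B : Set A) * V)) := by
  refine ⟨hAm.sepSubset_mul hD hU, fun hDV => ?_⟩
  have hinv : SepSubset (V⁻¹ * (B : Set A)) := by
    refine hAm.symm.sepSubset_mul (inf_comm B C ▸ hD) (fun v hv => ?_) ?_
    · simpa using hV hv
    · simpa [inf_comm C B] using hDV.inv
  simpa using hinv.inv
end

section
/- Let G be a group generated by a finite set X, let Q, R ≤ G be subgroups, set S = Q ∩ R, and let 𝒫 be a finite collection of subgroups of G such that: (S1) Q and R are separable in G; (S2) for every P ∈ 𝒫 the product PS is separable in G; (S3) for every P ∈ 𝒫 and all finite index subgroups K ≤_f P and T ≤_f Q satisfying S ⊆ T and T ∩ P ⊆ K, the product KT is separable in G; (S4) for every P ∈ 𝒫 and every finite index subgroup U ≤_f Q ∩ P with S ∩ P ⊆ U, the product U(R ∩ P) is separable in P. Then for all constants B, C ≥ 0 there exist finite index subgroups Q' ≤_f Q and R' ≤_f R satisfying (writing H_P = H ∩ P for a subgroup H): (C1) Q' ∩ R' = S; (C2) every element of Q⟨Q', R'⟩Q ∖ Q and every element of R⟨Q',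 R'⟩R ∖ R has word length at least B with respect to X; (C3) for every P ∈ 𝒫, every element of (PQ' ∪ PR') ∖ PS has word length at least C; (C4) for every P ∈ 𝒫, Q_P ∩ ⟨Q'_P, R'_P⟩ = Q'_P and R_P ∩ ⟨Q'_P, R'_P⟩ = R'_P; (C5) for every P ∈ 𝒫 and every q ∈ Q_P, every element of q⟨Q'_P, R'_P⟩R_P ∖ qQ'_P R_P has word length at least C. -/
open Pointwise

/-- The word length of `g` with respect to a generating set `X`: the least `n` such that
`g` is a product of `n` elements of `X ∪ X⁻¹`. -/
noncomputable def wordLength {G : Type*} [Group G] (X : Set G) (g : G) : ℕ :=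
  sInf {n : ℕ | ∃ l : List G, l.length = n ∧ (∀ x ∈ l, x ∈ X ∪ X⁻¹) ∧ l.prod = g}

/-- A finite family of conditions, each inherited by smaller subgroups and satisfied by some
finite index normal subgroup, is satisfied by a common finite index normal subgroup. -/
lemma exists_normal_finiteIndex_forall {G ι : Type*} [Group G] {s : Set ι} (hs : s.Finite)
    (φ : ι → Subgroup G → Prop) (hφ : ∀ i N M, M ≤ N → φ i N → φ i M)
    (h : ∀ i ∈ s, ∃ N : Subgroup G, N.Normal ∧ N.FiniteIndex ∧ φ i N) :
    ∃ N : Subgroup G, N.Normal ∧ N.FiniteIndex ∧ ∀ i ∈ s, φ i N := by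
  induction s, hs using Set.Finite.induction_on with
  | empty => exact ⟨⊤, inferInstance, inferInstance, by simp⟩
  | @insert a s _ _ ih =>
    obtain ⟨N, hN, hNf, hNs⟩ := ih fun i hi => h i (Set.mem_insert_of_mem _ hi)
    obtain ⟨M, hM, hMf, hMa⟩ := h a (Set.mem_insert _ _)
    refine ⟨N ⊓ M, inferInstance, inferInstance, ?_⟩
    rintro i (rfl | hi)
    · exact hφ _ _ _ inf_le_right hMa
    · exact hφ _ _ _ inf_le_left (hNs i hi)

lemma SepSubset.exists_normal_of_finite {G : Type*} [Group G] {Z : Set G} (hZ : SepSubset Z)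
    {E : Set G} (hE : E.Finite) :
    ∃ N : Subgroup G, N.Normal ∧ N.FiniteIndex ∧ ∀ g ∈ E, g ∈ Z * (N : Set G) → g ∈ Z := by
  refine exists_normal_finiteIndex_forall hE (fun g (N : Subgroup G) => g ∈ Z * (N : Set G) → g ∈ Z)
    (fun g N M hMN h hg => h (Set.mul_subset_mul_left hMN hg)) fun g _ => ?_
  by_cases hg : g ∈ Z
  · exact ⟨⊤, inferInstance, inferInstance, fun _ => hg⟩
  · obtain ⟨N, hN, hNf, hgN⟩ := hZ g hg
    exact ⟨N, hN, hNf, fun h => absurd h hgN⟩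

lemma finite_setOf_wordLength_lt {G : Type*} [Group G] {X : Set G} (hX : X.Finite)
    (hXgen : Subgroup.closure X = ⊤) (B : ℝ) : {g : G | (wordLength X g : ℝ) < B}.Finite := by
  have : Finite ↥(X ∪ X⁻¹) := (hX.union hX.inv).to_subtype
  refine ((List.finite_length_lt ↥(X ∪ X⁻¹) ⌈B⌉₊).image
    fun l => (l.map Subtype.val).prod).subset fun g hg => ?_
  have hne : {n : ℕ | ∃ l : List G,
      l.length = n ∧ (∀ x ∈ l, x ∈ X ∪ X⁻¹) ∧ l.prod = g}.Nonempty := by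
    have hg : g ∈ (Subgroup.closure X).toSubmonoid := by simp [hXgen]
    rw [Subgroup.closure_toSubmonoid] at hg
    obtain ⟨l, hl, hprod⟩ := Submonoid.exists_list_of_mem_closure hg
    exact ⟨_, l, rfl, hl, hprod⟩
  obtain ⟨l, hlen, hl, hprod⟩ := Nat.sInf_mem hne
  refine ⟨l.attachWith _ hl, ?_, by simpa using hprod⟩
  rw [Set.mem_ofPred_eq, List.length_attachWith, hlen]
  exact Nat.lt_ceil.2 hg

/-- A finite left transversal, up to repetition, of a subgroup of finite relative index. -/
lemma exists_finite_forall_eq_mul {G : Type*} [Group G] (H K : Subgroup G)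
    (h : (H.subgroupOf K).FiniteIndex) :
    ∃ F : Set G, F.Finite ∧ F ⊆ K ∧ ∀ k ∈ K, ∃ f ∈ F, ∃ x ∈ H, k = f * x := by
  refine ⟨Set.range fun c : K ⧸ H.subgroupOf K => (c.out : G), Set.finite_range _, ?_, ?_⟩
  · rintro _ ⟨c, rfl⟩
    exact c.out.2
  · intro k hk
    obtain ⟨x, hx⟩ := QuotientGroup.mk_out_eq_mul (H.subgroupOf K) ⟨k, hk⟩
    refine ⟨_, ⟨(⟨k, hk⟩ : K), rfl⟩, (x : G)⁻¹, H.inv_mem x.2, ?_⟩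
    simp [hx]

/-- If `K` has finite index in `P` and `KT` is separable with `T ∩ P ≤ K`, then `TN ∩ P ≤ K`
for some finite index normal subgroup `N`. -/
lemma exists_normal_sup_inf_le {G : Type*} [Group G] {P K T : Subgroup G} (hKP : K ≤ P)
    (hK : (K.subgroupOf P).FiniteIndex) (hTK : T ⊓ P ≤ K)
    (hsep : SepSubset ((K : Set G) * (T : Set G))) :
    ∃ N : Subgroup G, N.Normal ∧ N.FiniteIndex ∧ (T ⊔ N) ⊓ P ≤ K := by
  obtain ⟨F, hF, hFP, hcov⟩ := exists_finite_forall_eq_mul K P hK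
  obtain ⟨N, hN, hNf, hNF⟩ := hsep.exists_normal_of_finite hF.inv
  refine ⟨N, hN, hNf, ?_⟩
  rintro p ⟨hpT, hpP⟩
  obtain ⟨f, hf, x, hx, hpf⟩ := hcov p⁻¹ (P.inv_mem hpP)
  obtain ⟨t, ht, n, hn, rfl⟩ := Subgroup.mem_sup_of_normal_right.1 hpT
  have hfeq : f⁻¹ = x * t * n := by
    rw [mul_assoc, ← inv_inv (t * n), hpf]
    group
  obtain ⟨k, hk, t', ht', hkt⟩ := hNF f⁻¹ (Set.inv_mem_inv.2 hf)
    (hfeq ▸ Set.mul_mem_mul (Set.mul_mem_mul hx ht) hn)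
  have ht'K : t' ∈ K := by
    refine hTK ⟨ht', ?_⟩
    rw [← inv_mul_cancel_left k t']
    exact P.mul_mem (P.inv_mem (hKP hk)) ((congrArg (· ∈ P) hkt).mpr (P.inv_mem (hFP hf)))
  have hfK : f⁻¹ ∈ K := (congrArg (· ∈ K) hkt).mp (K.mul_mem hk ht'K)
  have htn : t * n = x⁻¹ * f⁻¹ := by rw [hfeq]; group
  rw [htn]
  exact K.mul_mem (K.inv_mem hx) hfK

/-- For a fixed finite index subgroup `T` of `Q` containing `Q ∩ R`, a finite index normal subgroup
`N` can be chosen so that `q(TN ∩ P)(R ∩ P)` meets a given finite set only inside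
`q(T ∩ P)(R ∩ P)`, uniformly in `q ∈ Q ∩ P`. -/
lemma exists_normal_coset_mul_inter_finite {G : Type*} [Group G] {Q R P T : Subgroup G}
    (hTf : (T.subgroupOf Q).FiniteIndex)
    (hKT : ∀ K : Subgroup G, K ≤ P → (K.subgroupOf P).FiniteIndex → T ⊓ P ≤ K →
      SepSubset ((K : Set G) * (T : Set G)))
    (hsep : SepSubset (↑((T ⊓ P).subgroupOf P) * ↑((R ⊓ P).subgroupOf P) : Set P))
    {E : Set G} (hE : E.Finite) :
    ∃ N : Subgroup G, N.Normal ∧ N.FiniteIndex ∧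
      ∀ q ∈ Q ⊓ P, ∀ y ∈ (T ⊔ N) ⊓ P, ∀ r ∈ R ⊓ P, q * y * r ∈ E →
        q * y * r ∈ ({q} : Set G) * ((T ⊓ P : Subgroup G) : Set G) *
          ((R ⊓ P : Subgroup G) : Set G) := by
  obtain ⟨F, hF, -, hcov⟩ := exists_finite_forall_eq_mul (T ⊓ P) (Q ⊓ P)
    ⟨Subgroup.relIndex_inter_ne_zero hTf.index_ne_zero P⟩
  have hE' : ((Subtype.val : P → G) ⁻¹' (F⁻¹ * E)).Finite :=
    (hF.inv.mul hE).preimage Subtype.val_injective.injOn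
  obtain ⟨M, hM, hMf, hME⟩ := hsep.exists_normal_of_finite hE'
  set L : Subgroup P := (T ⊓ P).subgroupOf P ⊔ M
  have hLf : L.FiniteIndex := Subgroup.finiteIndex_of_le (le_sup_right : M ≤ L)
  have hTL : T ⊓ P ≤ L.map P.subtype := fun t ht =>
    ⟨⟨t, ht.2⟩, (le_sup_left : _ ≤ L) (Subgroup.mem_subgroupOf.2 ht), rfl⟩
  have hLP : ((L.map P.subtype).subgroupOf P).FiniteIndex := by
    rwa [Subgroup.subgroupOf, Subgroup.comap_map_eq_self_of_injective P.subtype_injective]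
  obtain ⟨N, hN, hNf, hNL⟩ := exists_normal_sup_inf_le (Subgroup.map_subtype_le L) hLP hTL
    (hKT _ (Subgroup.map_subtype_le L) hLP hTL)
  refine ⟨N, hN, hNf, fun q hq y hy r hr hqyr => ?_⟩
  obtain ⟨f, hf, t, ht, rfl⟩ := hcov q hq
  obtain ⟨z, hz, hzy⟩ := hNL hy
  have hzy' : (z : G) = y := hzy
  obtain ⟨t₁, ht₁, m, hm, rfl⟩ := Subgroup.mem_sup_of_normal_right.1 hz
  have hmem : (⟨t, ht.2⟩ * (t₁ * m) * ⟨r, hr.2⟩ : P) ∈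
      (↑((T ⊓ P).subgroupOf P) * ↑((R ⊓ P).subgroupOf P) : Set P) := by
    refine hME _ ?_ ?_
    · refine ⟨f⁻¹, Set.inv_mem_inv.2 hf, _, hqyr, ?_⟩
      simp only [Subgroup.coe_mul] at hzy' ⊢
      rw [← hzy']
      group
    · refine ⟨⟨t, ht.2⟩ * t₁ * ⟨r, hr.2⟩, Set.mul_mem_mul (mul_mem ?_ ht₁) ?_,
        (⟨r, hr.2⟩ : P)⁻¹ * m * ⟨r, hr.2⟩, ?_, by group⟩
      · exact Subgroup.mem_subgroupOf.2 ht
      · exact Subgroup.mem_subgroupOf.2 hr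
      · simpa using hM.conj_mem m hm (⟨r, hr.2⟩ : P)⁻¹
  obtain ⟨t₂, ht₂, r₂, hr₂, h₂⟩ := hmem
  have h₂' : (t₂ : G) * r₂ = t * y * r := by
    rw [← hzy']
    exact congrArg Subtype.val h₂
  refine ⟨f * t * (t⁻¹ * t₂), Set.mul_mem_mul rfl ?_, r₂, Subgroup.mem_subgroupOf.1 hr₂, ?_⟩
  · exact mul_mem (inv_mem ht) (Subgroup.mem_subgroupOf.1 ht₂)
  · calc f * t * (t⁻¹ * t₂) * r₂ = f * (t₂ * r₂) := by group
      _ = f * t * y * r := by rw [h₂']; group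

/-- If `L` lies in `AN` with `N` normal, and `AN` meets `E` inside `A`, then so does `ALA`. -/
lemma mem_of_mem_mul_mul_of_le_sup {G : Type*} [Group G] {A L N : Subgroup G} [N.Normal]
    {E : Set G} (hE : ∀ g ∈ E, g ∈ (A : Set G) * (N : Set G) → g ∈ (A : Set G))
    (hL : L ≤ A ⊔ N) {g : G} (hg : g ∈ E)
    (hgL : g ∈ (A : Set G) * (L : Set G) * (A : Set G)) : g ∈ A := by
  obtain ⟨_, ⟨a, ha, l, hl, rfl⟩, b, hb, rfl⟩ := hgL
  refine hE _ hg ?_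
  rw [← Subgroup.mul_normal]
  exact mul_mem (mul_mem (Subgroup.mem_sup_left ha) (hL hl)) (Subgroup.mem_sup_left hb)

/-- Theorem 9.1 (separability assumptions yield the metric conditions (C1)–(C5)). -/
theorem stmt_12 {G : Type*} [Group G] (X : Set G) (hXfin : X.Finite)
    (hXgen : Subgroup.closure X = ⊤) (Q R : Subgroup G) (Ps : Finset (Subgroup G))
    -- (S1): Q and R are separable in G
    (hS1Q : SepSubset (Q : Set G)) (hS1R : SepSubset (R : Set G))
    -- (S2): PS is separable in G for each P ∈ Ps, where S = Q ⊓ R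
    (hS2 : ∀ P ∈ Ps, SepSubset ((P : Set G) * ((Q ⊓ R : Subgroup G) : Set G)))
    -- (S3): for all K ≤_f P, T ≤_f Q with S ⊆ T and T ∩ P ⊆ K, KT is separable in G
    (hS3 : ∀ P ∈ Ps, ∀ K T : Subgroup G, K ≤ P → (K.subgroupOf P).FiniteIndex →
      T ≤ Q → (T.subgroupOf Q).FiniteIndex → Q ⊓ R ≤ T → T ⊓ P ≤ K →
      SepSubset ((K : Set G) * (T : Set G)))
    -- (S4): for all U ≤_f Q ⊓ P with S ⊓ P ⊆ U, the double coset U(R ⊓ P) is separable in P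
    (hS4 : ∀ P ∈ Ps, ∀ U : Subgroup G, U ≤ Q ⊓ P → (U.subgroupOf (Q ⊓ P)).FiniteIndex →
      Q ⊓ R ⊓ P ≤ U →
      SepSubset ((↑(U.subgroupOf P) * ↑((R ⊓ P).subgroupOf P) : Set P)))
    (B C : ℝ) (hB : 0 ≤ B) (hC : 0 ≤ C) :
    ∃ Q' R' : Subgroup G,
      Q' ≤ Q ∧ (Q'.subgroupOf Q).FiniteIndex ∧
      R' ≤ R ∧ (R'.subgroupOf R).FiniteIndex ∧
      -- (C1)
      Q' ⊓ R' = Q ⊓ R ∧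
      -- (C2)
      (∀ g ∈ ((Q : Set G) * (↑(Q' ⊔ R') : Set G) * (Q : Set G)) \ (Q : Set G),
        B ≤ (wordLength X g : ℝ)) ∧
      (∀ g ∈ ((R : Set G) * (↑(Q' ⊔ R') : Set G) * (R : Set G)) \ (R : Set G),
        B ≤ (wordLength X g : ℝ)) ∧
      -- (C3)
      (∀ P ∈ Ps, ∀ g ∈ (((P : Set G) * (Q' : Set G)) ∪ ((P : Set G) * (R' : Set G))) \
          ((P : Set G) * ((Q ⊓ R : Subgroup G) : Set G)),
        C ≤ (wordLength X g : ℝ)) ∧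
      -- (C4)
      (∀ P ∈ Ps, Q ⊓ P ⊓ ((Q' ⊓ P) ⊔ (R' ⊓ P)) = Q' ⊓ P ∧
        R ⊓ P ⊓ ((Q' ⊓ P) ⊔ (R' ⊓ P)) = R' ⊓ P) ∧
      -- (C5)
      (∀ P ∈ Ps, ∀ q ∈ Q ⊓ P,
        ∀ g ∈ (({q} : Set G) * (↑((Q' ⊓ P) ⊔ (R' ⊓ P)) : Set G) *
            ((R ⊓ P : Subgroup G) : Set G)) \
          (({q} : Set G) * ((Q' ⊓ P : Subgroup G) : Set G) * ((R ⊓ P : Subgroup G) : Set G)),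
        C ≤ (wordLength X g : ℝ)) := by
  set E : Set G := {g | (wordLength X g : ℝ) < max B C}
  have hE : E.Finite := finite_setOf_wordLength_lt hXfin hXgen _
  have hEB : ∀ g, g ∉ E → B ≤ (wordLength X g : ℝ) := fun g h =>
    (le_max_left B C).trans (not_lt.1 h)
  have hEC : ∀ g, g ∉ E → C ≤ (wordLength X g : ℝ) := fun g h =>
    (le_max_right B C).trans (not_lt.1 h)
  obtain ⟨N₁, hN₁, hN₁f, hN₁E⟩ := hS1Q.exists_normal_of_finite hE
  obtain ⟨N₂, hN₂, hN₂f, hN₂E⟩ := hS1R.exists_normal_of_finite hE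
  obtain ⟨N₃, hN₃, hN₃f, hN₃E⟩ := exists_normal_finiteIndex_forall Ps.finite_toSet
    (fun P (N : Subgroup G) => ∀ g ∈ E,
      g ∈ (P : Set G) * ((Q ⊓ R : Subgroup G) : Set G) * (N : Set G) →
      g ∈ (P : Set G) * ((Q ⊓ R : Subgroup G) : Set G))
    (fun P N M hMN h g hg hgM => h g hg (Set.mul_subset_mul_left hMN hgM))
    fun P hP => (hS2 P hP).exists_normal_of_finite hE
  set N : Subgroup G := N₁ ⊓ N₂ ⊓ N₃
  set L : Subgroup G := (Q ⊓ R) ⊔ N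
  have hLf : L.FiniteIndex := Subgroup.finiteIndex_of_le (le_sup_right : N ≤ L)
  have hSL : Q ⊓ R ≤ L := le_sup_left
  set T : Subgroup G := Q ⊓ L with hTdef
  have hTf : (T.subgroupOf Q).FiniteIndex := by
    rw [hTdef, Subgroup.inf_subgroupOf_left]
    infer_instance
  have hST : Q ⊓ R ≤ T := le_inf inf_le_left hSL
  obtain ⟨M, hM, hMf, hME⟩ := exists_normal_finiteIndex_forall Ps.finite_toSet
    (fun P (N : Subgroup G) => ∀ q ∈ Q ⊓ P, ∀ y ∈ (T ⊔ N) ⊓ P, ∀ r ∈ R ⊓ P, q * y * r ∈ E →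
      q * y * r ∈ ({q} : Set G) * ((T ⊓ P : Subgroup G) : Set G) *
        ((R ⊓ P : Subgroup G) : Set G))
    (fun P N M hMN h q hq y hy => h q hq y (inf_le_inf_right P (sup_le_sup_left hMN T) hy))
    fun P hP => exists_normal_coset_mul_inter_finite hTf
      (fun K hKP hK hTK => hS3 P hP K T hKP hK inf_le_left hTf hST hTK)
      (hS4 P hP (T ⊓ P) (inf_le_inf_right P inf_le_left)
        ⟨Subgroup.relIndex_inter_ne_zero hTf.index_ne_zero P⟩ (inf_le_inf_right P hST)) hE
  have hTMf : (T ⊔ M).FiniteIndex := Subgroup.finiteIndex_of_le (le_sup_right : M ≤ T ⊔ M)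
  set R' : Subgroup G := R ⊓ (L ⊓ (T ⊔ M)) with hR'def
  have hR'f : (R'.subgroupOf R).FiniteIndex := by
    rw [hR'def, Subgroup.inf_subgroupOf_left]
    infer_instance
  have hjoinL : T ⊔ R' ≤ L := sup_le inf_le_right (inf_le_right.trans inf_le_left)
  have hjoinT : T ⊔ R' ≤ T ⊔ M := sup_le le_sup_left (inf_le_right.trans inf_le_right)
  have hjoinP : ∀ P : Subgroup G, (T ⊓ P) ⊔ (R' ⊓ P) ≤ (T ⊔ R') ⊓ P := fun P =>
    le_inf (sup_le_sup inf_le_left inf_le_left) (sup_le inf_le_right inf_le_right)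
  refine ⟨T, R', inf_le_left, hTf, inf_le_left, hR'f, ?_, ?_, ?_, ?_, ?_, ?_⟩
  · exact le_antisymm (inf_le_inf inf_le_left inf_le_left)
      (le_inf hST (le_inf inf_le_right (le_inf hSL (hST.trans le_sup_left))))
  · rintro g ⟨hg, hgQ⟩
    refine hEB g fun hgE => hgQ (mem_of_mem_mul_mul_of_le_sup hN₁E (hjoinL.trans ?_) hgE hg)
    exact sup_le_sup inf_le_left (inf_le_left.trans inf_le_left)
  · rintro g ⟨hg, hgR⟩
    refine hEB g fun hgE => hgR (mem_of_mem_mul_mul_of_le_sup hN₂E (hjoinL.trans ?_) hgE hg)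
    exact sup_le_sup inf_le_right (inf_le_left.trans inf_le_right)
  · rintro P hP g ⟨hg, hgS⟩
    refine hEC g fun hgE => hgS (hN₃E P hP g hgE ?_)
    have hgL : g ∈ (P : Set G) * (L : Set G) := by
      rcases hg with hg | hg
      · exact Set.mul_subset_mul_left (SetLike.coe_subset_coe.2 (le_sup_left.trans hjoinL)) hg
      · exact Set.mul_subset_mul_left (SetLike.coe_subset_coe.2 (le_sup_right.trans hjoinL)) hg
    rw [mul_assoc, ← Subgroup.mul_normal]
    exact Set.mul_subset_mul_left (SetLike.coe_subset_coe.2 (sup_le_sup_left inf_le_right _)) hgL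
  · intro P _
    refine ⟨le_antisymm ?_ (le_inf (inf_le_inf_right P inf_le_left) le_sup_left),
      le_antisymm ?_ (le_inf (inf_le_inf_right P inf_le_left) le_sup_right)⟩
    · rintro g ⟨⟨hgQ, hgP⟩, hg⟩
      exact ⟨⟨hgQ, hjoinL (hjoinP P hg).1⟩, hgP⟩
    · rintro g ⟨⟨hgR, hgP⟩, hg⟩
      exact ⟨⟨hgR, hjoinL (hjoinP P hg).1, hjoinT (hjoinP P hg).1⟩, hgP⟩
  · rintro P hP q hq g ⟨⟨_, ⟨_, rfl, y, hy, rfl⟩, r, hr, rfl⟩, hg⟩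
    refine hEC _ fun hgE => hg (hME P hP _ hq y ?_ r hr hgE)
    exact inf_le_inf_right P hjoinT (hjoinP P hy)
end

section
/- Let G be a group generated by a finite set X and let m ∈ ℕ₀. Let Q, R ≤ G be subgroups and let 𝒫 and 𝒰 be finite collections of subgroups of G such that: (1) every P ∈ 𝒫 has property RZ_{m+2}; (2) for all P ∈ 𝒫 and all U ∈ 𝒰, the subgroups Q ∩ P, R ∩ P and U ∩ P are finitely generated; (3) for every P ∈ 𝒫 and all finite index subgroups K ≤_f P and L ≤_f Q, the product KL is separable in G. Then for every constant C ≥ 0 and every finite index subgroup Q' ≤_f Q there exists a finite index subgroup O ≤_f G with Q' ⊆ O such that for every subgroup R' ≤ R ∩ O the following holds (writing H_P = H ∩ P): for each P ∈ 𝒫, every q ∈ Q_P, every j ∈ {0, …, m} and all U_1, …, U_j ∈ 𝒰, every element of q⟨Q'_P, R'_P⟩R_P(U_1)_P⋯(U_j)_P ∖ qQ'_P R_P(U_1)_P⋯(U_j)_P has word length at least C with respect to X. -/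
open Pointwise

/-- A group `P` has property `RZ_s`: for arbitrary finitely generated subgroups
`E_1, …, E_s ≤ P` the product `E_1 ⋯ E_s` is separable in `P`. -/
def HasRZ (P : Type*) [Group P] (s : ℕ) : Prop :=
  ∀ E : Fin s → Subgroup P, (∀ i, (E i).FG) →
    SepSubset ((List.ofFn fun i => ((E i : Subgroup P) : Set P)).prod)

/-- Property `RZ_s` passes to smaller values of `s`. -/
theorem HasRZ.anti {P : Type*} [Group P] {s t : ℕ} (h : HasRZ P t) (hst : s ≤ t) :
    HasRZ P s := by
  induction hst with
  | refl => exact h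
  | step _ ih =>
    refine ih fun E hE => ?_
    have := h (Fin.cons ⊥ E) (Fin.cases Subgroup.FG.bot hE)
    simpa [List.ofFn_succ, Set.singleton_one] using this

/-- In a group with `RZ_s`, products of at most `s` finitely generated subgroups are separable. -/
theorem HasRZ.sepSubset_list_prod {P : Type*} [Group P] {s : ℕ} (h : HasRZ P s)
    (l : List (Subgroup P)) (hl : l.length ≤ s) (hfg : ∀ E ∈ l, E.FG) :
    SepSubset (l.map fun E : Subgroup P => (E : Set P)).prod := by
  have := h.anti hl l.get fun i => hfg _ (List.get_mem l i)
  rwa [← Function.comp_def, ← List.map_ofFn, List.ofFn_get] at this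

theorem SepSubset.singleton_mul {G : Type*} [Group G] {Z : Set G} (hZ : SepSubset Z) (q : G) :
    SepSubset ({q} * Z) := by
  intro g hg
  obtain ⟨N, hN, hNf, hgN⟩ := hZ (q⁻¹ * g) (by simpa using hg)
  exact ⟨N, hN, hNf, by rw [mul_assoc]; simpa using hgN⟩

/-- Finitely many elements are separated from finitely many separable subsets by a single
finite index normal subgroup. -/
theorem SepSubset.exists_uniform {G : Type*} [Group G] {S : Set (Set G)} (hS : S.Finite)
    (hsep : ∀ Z ∈ S, SepSubset Z) {B : Set G} (hB : B.Finite) :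
    ∃ N : Subgroup G, N.Normal ∧ N.FiniteIndex ∧
      ∀ Z ∈ S, ∀ b ∈ B, b ∈ Z * (N : Set G) → b ∈ Z := by
  have key : ∀ x : S × B, ∃ N : Subgroup G, N.Normal ∧ N.FiniteIndex ∧
      ((x.2 : G) ∈ (x.1 : Set G) * (N : Set G) → (x.2 : G) ∈ (x.1 : Set G)) := by
    rintro ⟨⟨Z, hZ⟩, b, hb⟩
    by_cases hbZ : b ∈ Z
    · exact ⟨⊤, inferInstance, inferInstance, fun _ => hbZ⟩
    · obtain ⟨N, hN, hNf, h⟩ := hsep Z hZ b hbZ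
      exact ⟨N, hN, hNf, fun h' => absurd h' h⟩
  choose N hN hNf hNsep using key
  have := hS.to_subtype
  have := hB.to_subtype
  refine ⟨⨅ x, N x, Subgroup.normal_iInf_normal hN, Subgroup.finiteIndex_iInf hNf, ?_⟩
  intro Z hZ b hb hbZ
  refine hNsep ⟨⟨Z, hZ⟩, b, hb⟩ (Set.mul_subset_mul_left ?_ hbZ)
  exact SetLike.coe_subset_coe.2 (iInf_le N _)

/-- Balls with respect to a finite generating set are finite. -/
theorem finite_wordLength_lt {G : Type*} [Group G] {X : Set G} (hX : X.Finite)
    (hgen : Subgroup.closure X = ⊤) (C : ℝ) : {g : G | (wordLength X g : ℝ) < C}.Finite := by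
  have hY : (X ∪ X⁻¹).Finite := hX.union hX.inv
  have := hY.to_subtype
  refine ((List.finite_length_le ↥(X ∪ X⁻¹) ⌈C⌉₊).image
    fun l => (l.map Subtype.val).prod).subset fun g hg => ?_
  have hne : {n : ℕ | ∃ l : List G, l.length = n ∧ (∀ x ∈ l, x ∈ X ∪ X⁻¹) ∧
      l.prod = g}.Nonempty := by
    obtain ⟨l, hl, hlg⟩ := Submonoid.exists_list_of_mem_closure (s := X ∪ X⁻¹) (x := g)
      (by rw [← Subgroup.closure_toSubmonoid, hgen]; trivial)
    exact ⟨_, l, rfl, hl, hlg⟩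
  obtain ⟨l, hlen, hl, hlg⟩ := Nat.sInf_mem hne
  lift l to List ↥(X ∪ X⁻¹) using hl
  refine ⟨l, ?_, hlg⟩
  rw [List.length_map] at hlen
  have hlt : (l.length : ℝ) < C := by rw [hlen]; exact hg
  exact_mod_cast hlt.le.trans (Nat.le_ceil C)

/-- There are finitely many products of `j` factors from a finite set. -/
theorem finite_list_range_prod {α M : Type*} [Monoid M] {s : Set α} (hs : s.Finite) (f : α → M)
    (j : ℕ) :
    {W : M | ∃ U : ℕ → α, (∀ i < j, U i ∈ s) ∧
      W = ((List.range j).map fun i => f (U i)).prod}.Finite := by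
  induction j with
  | zero => exact (Set.finite_singleton (1 : M)).subset (by rintro _ ⟨U, -, rfl⟩; simp)
  | succ j ih =>
    refine (ih.image2 (· * ·) (hs.image f)).subset ?_
    rintro _ ⟨U, hU, rfl⟩
    refine ⟨_, ⟨U, fun i hi => hU i (hi.trans j.lt_succ_self), rfl⟩, f (U j),
      ⟨_, hU j j.lt_succ_self, rfl⟩, ?_⟩
    simp [List.range_succ]

/-- A subgroup has finitely many left cosets by elements of a subgroup in which it has finite
relative index. -/
theorem Subgroup.finite_setOf_singleton_mul {G : Type*} [Group G] (H K : Subgroup G)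
    [(H.subgroupOf K).FiniteIndex] :
    {Z : Set G | ∃ q ∈ K, Z = ({q} : Set G) * (H : Set G)}.Finite := by
  refine (Set.finite_range fun x : K ⧸ H.subgroupOf K =>
    ({(x.out : G)} : Set G) * (H : Set G)).subset ?_
  rintro _ ⟨q, hq, rfl⟩
  refine ⟨QuotientGroup.mk (⟨q, hq⟩ : K), ?_⟩
  have h := QuotientGroup.eq.1 (QuotientGroup.out_eq' (QuotientGroup.mk (s := H.subgroupOf K)
    (⟨q, hq⟩ : K)))
  simp only [Set.singleton_mul]
  exact (leftCoset_eq_iff H).2 (by simpa [Subgroup.mem_subgroupOf] using h)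

theorem Subgroup.FG.of_map_subtype {G : Type*} [Group G] {P : Subgroup G} {H : Subgroup P}
    (h : (H.map P.subtype).FG) : H.FG := by
  rw [← Group.fg_iff_subgroup_fg] at h ⊢
  exact Group.fg_of_surjective (f := (H.equivMapOfInjective _ P.subtype_injective).symm.toMonoidHom)
    (MulEquiv.surjective _)

/-- If `N` is a finite index normal subgroup of `P` and `NH` is separable in `G`, then `H` lies
in a finite index subgroup of `G` whose intersection with `P` is contained in `(H ∩ P)N`. -/
theorem exists_finiteIndex_inf_le {G : Type*} [Group G] (P H : Subgroup G) (N : Subgroup P)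
    [N.Normal] [N.FiniteIndex]
    (hsep : SepSubset ((N.map P.subtype : Set G) * (H : Set G))) :
    ∃ O : Subgroup G, O.FiniteIndex ∧ H ≤ O ∧ O.subgroupOf P ≤ H.subgroupOf P ⊔ N := by
  obtain ⟨M, hM, hMf, hMsep⟩ := SepSubset.exists_uniform (Set.finite_singleton _)
    (by simpa using hsep) (Set.finite_range fun x : P ⧸ N => ((x.out : P) : G))
  refine ⟨H ⊔ M, Subgroup.finiteIndex_of_le le_sup_right, le_sup_left, fun x hx => ?_⟩
  rw [Subgroup.mem_subgroupOf, Subgroup.mem_sup_of_normal_right] at hx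
  obtain ⟨h, hh, n, hn, hx⟩ := hx
  set y : P := (QuotientGroup.mk (s := N) x).out
  have hxy : x⁻¹ * y ∈ N := QuotientGroup.eq.1 (QuotientGroup.out_eq' _).symm
  have hyx : y * x⁻¹ ∈ N := ‹N.Normal›.mem_comm hxy
  have hmem := hMsep _ rfl (y : G) ⟨_, rfl⟩
    ⟨((y * x⁻¹ : P) : G) * h, ⟨_, ⟨_, hyx, rfl⟩, h, hh, rfl⟩, n, hn, by simp [mul_assoc, hx]⟩
  obtain ⟨_, ⟨k, hk, rfl⟩, h', hh', hkh⟩ := hmem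
  have hmemH : k⁻¹ * y ∈ H.subgroupOf P := by
    rw [Subgroup.mem_subgroupOf]
    have : ((k⁻¹ * y : P) : G) = h' := by simp [← hkh]
    rwa [this]
  have hx' : x = k * (k⁻¹ * y) * (x⁻¹ * y)⁻¹ := by group
  rw [hx']
  exact mul_mem (mul_mem (Subgroup.mem_sup_right hk) (Subgroup.mem_sup_left hmemH))
    (Subgroup.mem_sup_right (inv_mem hxy))

theorem Subgroup.coe_inf_eq_image {G : Type*} [Group G] (H P : Subgroup G) :
    ((H ⊓ P : Subgroup G) : Set G) = P.subtype '' (H.subgroupOf P : Set P) := by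
  rw [← Subgroup.subgroupOf_map_subtype, Subgroup.coe_map]

/-- The case of a single subgroup `P`. -/
theorem exists_finiteIndex_wordLength_ge {G : Type*} [Group G] {X : Set G} (hXfin : X.Finite)
    (hXgen : Subgroup.closure X = ⊤) (m : ℕ) {Q R P : Subgroup G} (Us : Finset (Subgroup G))
    (hRZ : HasRZ P (m + 2)) (hQ : (Q ⊓ P).FG) (hR : (R ⊓ P).FG) (hU : ∀ U ∈ Us, (U ⊓ P).FG)
    (Q' : Subgroup G) (hQ'le : Q' ≤ Q) (hQ'fi : (Q'.subgroupOf Q).FiniteIndex)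
    (hsep : ∀ K : Subgroup G, K ≤ P → (K.subgroupOf P).FiniteIndex →
      SepSubset ((K : Set G) * (Q' : Set G)))
    (C : ℝ) :
    ∃ O : Subgroup G, O.FiniteIndex ∧ Q' ≤ O ∧
      ∀ R' : Subgroup G, R' ≤ R ⊓ O →
        ∀ q ∈ Q ⊓ P, ∀ j ≤ m, ∀ U : ℕ → Subgroup G, (∀ i < j, U i ∈ Us) →
          ∀ g ∈ (({q} : Set G) * (↑((Q' ⊓ P) ⊔ (R' ⊓ P)) : Set G) *
              ((R ⊓ P : Subgroup G) : Set G) *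
              ((List.range j).map fun i => ((U i ⊓ P : Subgroup G) : Set G)).prod) \
            (({q} : Set G) * ((Q' ⊓ P : Subgroup G) : Set G) *
              ((R ⊓ P : Subgroup G) : Set G) *
              ((List.range j).map fun i => ((U i ⊓ P : Subgroup G) : Set G)).prod),
          C ≤ (wordLength X g : ℝ) := by
  have hfiP : ((Q'.subgroupOf P).subgroupOf (Q.subgroupOf P)).FiniteIndex :=
    ⟨Subgroup.relIndex_comap_ne_zero P.subtype hQ'fi.index_ne_zero⟩
  have hfg : ∀ {H : Subgroup G}, (H ⊓ P).FG → (H.subgroupOf P).FG := fun {H} h =>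
    Subgroup.FG.of_map_subtype (by rwa [Subgroup.subgroupOf_map_subtype])
  have hQ'fg : (Q'.subgroupOf P).FG := by
    have := (Group.fg_iff_subgroup_fg _).2 (hfg hQ)
    have := ((Q'.subgroupOf P).subgroupOf (Q.subgroupOf P)).fg_of_index_ne_zero
    rw [← Group.fg_iff_subgroup_fg]
    exact Group.fg_of_surjective (f := (Subgroup.subgroupOfEquivOfLe
      (Subgroup.subgroupOf_mono P hQ'le)).toMonoidHom)
      (MulEquiv.surjective _)
  set S : Set (Set P) := {Z | ∃ q ∈ Q.subgroupOf P, ∃ j ≤ m, ∃ U : ℕ → Subgroup G,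
    (∀ i < j, U i ∈ Us) ∧ Z = ({q} * (Q'.subgroupOf P : Set P)) * ((R.subgroupOf P : Set P) *
      ((List.range j).map fun i => ((U i).subgroupOf P : Set P)).prod)}
  have hSfin : S.Finite := by
    have h1 := (Q'.subgroupOf P).finite_setOf_singleton_mul (Q.subgroupOf P)
    have h2 := (Set.finite_le_nat m).biUnion fun j _ => finite_list_range_prod Us.finite_toSet
      (fun U : Subgroup G => (U.subgroupOf P : Set P)) j
    refine (h1.image2 (fun A W => A * ((R.subgroupOf P : Set P) * W)) h2).subset ?_
    rintro _ ⟨q, hq, j, hj, U, hUs, rfl⟩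
    exact ⟨_, ⟨q, hq, rfl⟩, _, Set.mem_biUnion hj ⟨U, hUs, rfl⟩, rfl⟩
  have hSsep : ∀ Z ∈ S, SepSubset Z := by
    rintro _ ⟨q, hq, j, hj, U, hUs, rfl⟩
    have := (hRZ.sepSubset_list_prod (Q'.subgroupOf P :: R.subgroupOf P ::
      (List.range j).map fun i => (U i).subgroupOf P) (by simpa using hj) (by
        simp only [List.mem_cons, List.mem_map, List.mem_range]
        rintro _ (rfl | rfl | ⟨i, hi, rfl⟩)
        exacts [hQ'fg, hfg hR, hfg (hU _ (hUs i hi))])).singleton_mul q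
    simpa only [List.map_cons, List.prod_cons, List.map_map, Function.comp_def, mul_assoc] using this
  have hB : {b : P | (wordLength X (b : G) : ℝ) < C}.Finite :=
    (finite_wordLength_lt hXfin hXgen C).preimage Subtype.val_injective.injOn
  obtain ⟨N, hN, hNf, hNsep⟩ := SepSubset.exists_uniform hSfin hSsep hB
  obtain ⟨O, hOf, hQO, hO⟩ := exists_finiteIndex_inf_le P Q' N
    (hsep (N.map P.subtype) (Subgroup.map_subtype_le N)
      (by rwa [Subgroup.subgroupOf, Subgroup.comap_map_eq_self_of_injective P.subtype_injective]))
  refine ⟨O, hOf, hQO, fun R' hR' q hq j hj U hUs g hg => ?_⟩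
  by_contra! hlt
  obtain ⟨hg, hg'⟩ := hg
  lift q to P using hq.2
  have hsup : (((Q' ⊓ P) ⊔ (R' ⊓ P) : Subgroup G) : Set G) ⊆
      P.subtype '' ((Q'.subgroupOf P : Set P) * (N : Set P)) := by
    rw [← Subgroup.mul_normal, ← Subgroup.coe_map, SetLike.coe_subset_coe,
      ← Subgroup.subgroupOf_map_subtype, ← Subgroup.subgroupOf_map_subtype, ← Subgroup.map_sup]
    refine Subgroup.map_mono (sup_le le_sup_left ((Subgroup.comap_mono ?_).trans hO))
    exact hR'.trans inf_le_right
  have hprod : ((List.range j).map fun i => ((U i ⊓ P : Subgroup G) : Set G)).prod =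
      P.subtype '' ((List.range j).map fun i => ((U i).subgroupOf P : Set P)).prod := by
    rw [Set.image_list_prod, List.map_map]
    simp only [Subgroup.coe_inf_eq_image, Function.comp_def]
  have hq' : ({(q : G)} : Set G) = P.subtype '' {q} := by simp
  rw [hprod, hq', Subgroup.coe_inf_eq_image R] at hg hg'
  rw [Subgroup.coe_inf_eq_image Q'] at hg'
  replace hg := Set.mul_subset_mul_right (Set.mul_subset_mul_right
    (Set.mul_subset_mul_left hsup)) hg
  simp only [← Set.image_mul] at hg hg'
  obtain ⟨b, hb, rfl⟩ := hg
  refine hg' ⟨b, ?_, rfl⟩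
  have hZ := hNsep _ ⟨q, hq.1, j, hj, U, hUs, rfl⟩ b hlt
  rw [mul_assoc _ _ (N : Set P), Subgroup.set_mul_normal_comm _ N] at hZ
  simp only [mul_assoc] at hZ hb ⊢
  exact hZ hb

/-- Lemma 12.2: under the hypotheses (1)–(3) on the finite collections `Ps` and `Us`,
for every `C ≥ 0` and every `Q' ≤_f Q` there is `O ≤_f G` with `Q' ⊆ O` such that for all
`R' ≤ R ⊓ O` condition (C5-m) holds.
Here a choice `U_1, …, U_j ∈ Us` is encoded by `U : ℕ → Subgroup G` with `U i ∈ Us` for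
`i < j`, and `(U_1)_P ⋯ (U_j)_P` is `((List.range j).map fun i => (↑(U i ⊓ P))).prod`. -/
theorem stmt_16 {G : Type*} [Group G] (X : Set G) (hXfin : X.Finite)
    (hXgen : Subgroup.closure X = ⊤) (m : ℕ) (Q R : Subgroup G)
    (Ps Us : Finset (Subgroup G))
    -- (1): every P ∈ Ps has property RZ_{m+2}
    (h1 : ∀ P ∈ Ps, HasRZ P (m + 2))
    -- (2): the subgroups Q ∩ P, R ∩ P and U ∩ P are finitely generated
    (h2 : ∀ P ∈ Ps, (Q ⊓ P).FG ∧ (R ⊓ P).FG ∧ ∀ U ∈ Us, (U ⊓ P).FG)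
    -- (3): for all K ≤_f P and L ≤_f Q, the product KL is separable in G
    (h3 : ∀ P ∈ Ps, ∀ K L : Subgroup G, K ≤ P → (K.subgroupOf P).FiniteIndex →
      L ≤ Q → (L.subgroupOf Q).FiniteIndex →
      SepSubset ((K : Set G) * (L : Set G)))
    (C : ℝ) (hC : 0 ≤ C) (Q' : Subgroup G) (hQ'le : Q' ≤ Q)
    (hQ'fi : (Q'.subgroupOf Q).FiniteIndex) :
    ∃ O : Subgroup G, O.FiniteIndex ∧ Q' ≤ O ∧
      ∀ R' : Subgroup G, R' ≤ R ⊓ O →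
        ∀ P ∈ Ps, ∀ q ∈ Q ⊓ P, ∀ j ≤ m, ∀ U : ℕ → Subgroup G, (∀ i < j, U i ∈ Us) →
          ∀ g ∈ (({q} : Set G) * (↑((Q' ⊓ P) ⊔ (R' ⊓ P)) : Set G) *
              ((R ⊓ P : Subgroup G) : Set G) *
              ((List.range j).map fun i => ((U i ⊓ P : Subgroup G) : Set G)).prod) \
            (({q} : Set G) * ((Q' ⊓ P : Subgroup G) : Set G) *
              ((R ⊓ P : Subgroup G) : Set G) *
              ((List.range j).map fun i => ((U i ⊓ P : Subgroup G) : Set G)).prod),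
          C ≤ (wordLength X g : ℝ) := by
  choose! O hOf hQO hO using fun P hP => exists_finiteIndex_wordLength_ge hXfin hXgen m Us
    (h1 P hP) (h2 P hP).1 (h2 P hP).2.1 (h2 P hP).2.2 Q' hQ'le hQ'fi
    (fun K hK hKf => h3 P hP K Q' hK hKf hQ'le hQ'fi) C
  refine ⟨⨅ P ∈ Ps, O P, Subgroup.finiteIndex_iInf' O hOf, le_iInf₂ hQO, fun R' hR' P hP => ?_⟩
  exact hO P hP R' (hR'.trans (inf_le_inf_left R (iInf₂_le P hP)))
end

section
/- Let G be a group with finitely generated subgroups F_1, …, F_n ≤ G, where n ≥ 2. Suppose there exist a finite index subgroup G' ≤_f G and an index i ∈ {1, …, n} such that F_i' := F_i ∩ G' is a normal subgroup of G' and the quotient group G'/F_i' has property RZ_{n-1}. Then the product F_1⋯F_n is separable in G. -/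
open Pointwise

/-- The set of products of the members of a list of subgroups, in the order of the list. -/
def subgroupListProd {G : Type*} [Group G] (L : List (Subgroup G)) : Set G :=
  (L.map fun H : Subgroup G => (H : Set G)).prod

section SubgroupListProd

variable {G P : Type*} [Group G] [Group P]

theorem subgroupListProd_cons (H : Subgroup G) (L : List (Subgroup G)) :
    subgroupListProd (H :: L) = (H : Set G) * subgroupListProd L := by
  simp [subgroupListProd]

theorem subgroupListProd_append (L M : List (Subgroup G)) :
    subgroupListProd (L ++ M) = subgroupListProd L * subgroupListProd M := by
  simp [subgroupListProd]

theorem image_subgroupListProd (f : G →* P) (L : List (Subgroup G)) :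
    f '' subgroupListProd L = subgroupListProd (L.map fun H => H.map f) := by
  simp only [subgroupListProd, Set.image_list_prod, List.map_map]
  congr 1

theorem mul_singleton_eq_singleton_mul_image_conj (g : G) (Z : Set G) :
    Z * {g} = {g} * (MulAut.conj g⁻¹).toMonoidHom '' Z := by
  ext x
  simp only [Set.mul_singleton, Set.singleton_mul, Set.image_image, Set.mem_image]
  simp [mul_assoc]

theorem singleton_mul_eq_image_conj_mul_singleton (g : G) (Z : Set G) :
    {g} * Z = (MulAut.conj g).toMonoidHom '' Z * {g} := by
  ext x
  simp only [Set.mul_singleton, Set.singleton_mul, Set.image_image, Set.mem_image]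
  simp [mul_assoc]

end SubgroupListProd

section FiniteGeneration

variable {G P : Type*} [Group G] [Group P]

theorem Subgroup.FG.map_monoidHom {H : Subgroup G} (hH : H.FG) (f : G →* P) : (H.map f).FG := by
  rw [← Group.fg_iff_subgroup_fg] at hH ⊢
  exact Group.fg_of_surjective (f.subgroupMap_surjective H)

theorem Subgroup.FG.subgroupOf_of_le {H K : Subgroup G} (hH : H.FG) (h : H ≤ K) :
    (H.subgroupOf K).FG := by
  rw [← Group.fg_iff_subgroup_fg] at hH ⊢
  exact Group.fg_of_surjective (f := (Subgroup.subgroupOfEquivOfLe h).symm.toMonoidHom)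
    (Subgroup.subgroupOfEquivOfLe h).symm.surjective

theorem Subgroup.FG.inf_of_finiteIndex {H : Subgroup G} (hH : H.FG) (K : Subgroup G)
    [K.FiniteIndex] : (H ⊓ K).FG := by
  have : Group.FG H := (Group.fg_iff_subgroup_fg H).2 hH
  have h := (Group.fg_iff_subgroup_fg (K.subgroupOf H)).1 inferInstance
  have h' := h.map_monoidHom H.subtype
  rwa [Subgroup.subgroupOf_map_subtype, inf_comm] at h'

theorem Subgroup.exists_finite_mul_inf_eq (H K : Subgroup G) [K.FiniteIndex] :
    ∃ B : Set G, B.Finite ∧ (H : Set G) = B * ((H ⊓ K : Subgroup G) : Set G) := by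
  refine ⟨Set.range fun q : H ⧸ K.subgroupOf H => (q.out : G), Set.finite_range _, ?_⟩
  ext x
  constructor
  · intro hx
    refine Set.mem_mul.2 ⟨_, ⟨((⟨x, hx⟩ : H) : H ⧸ K.subgroupOf H), rfl⟩, _, ?_,
      mul_inv_cancel_left _ x⟩
    have h : (((⟨x, hx⟩ : H) : H ⧸ K.subgroupOf H).out)⁻¹ * ⟨x, hx⟩ ∈ K.subgroupOf H :=
      QuotientGroup.eq.1 (Quotient.out_eq _)
    exact ⟨H.mul_mem (H.inv_mem (Subtype.property _)) hx, h⟩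
  · rintro ⟨_, ⟨q, rfl⟩, y, hy, rfl⟩
    exact H.mul_mem q.out.2 hy.1

theorem Subgroup.exists_finite_inf_mul_eq (H K : Subgroup G) [K.FiniteIndex] :
    ∃ B : Set G, B.Finite ∧ (H : Set G) = ((H ⊓ K : Subgroup G) : Set G) * B := by
  obtain ⟨B, hB, h⟩ := H.exists_finite_mul_inf_eq K
  refine ⟨B⁻¹, hB.inv, ?_⟩
  have := congrArg (·⁻¹) h
  simpa only [mul_inv_rev, inv_coe_set] using this

/-- A product of finitely generated subgroups is a finite union of right translates of products
of finitely generated subgroups of a given normal subgroup of finite index. -/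
theorem exists_finite_biUnion_eq_subgroupListProd (N : Subgroup G) [N.Normal] [N.FiniteIndex]
    (L : List (Subgroup G)) (hL : ∀ H ∈ L, H.FG) :
    ∃ T : Set (List (Subgroup G) × G), T.Finite ∧
      (∀ t ∈ T, t.1.length = L.length ∧ ∀ H ∈ t.1, H.FG ∧ H ≤ N) ∧
      subgroupListProd L = ⋃ t ∈ T, subgroupListProd t.1 * {t.2} := by
  induction L with
  | nil => exact ⟨{([], 1)}, Set.finite_singleton _, by simp, by simp [subgroupListProd]⟩
  | cons H L ih =>
    obtain ⟨T, hT, hT', hprod⟩ := ih fun K hK => hL K (List.mem_cons_of_mem _ hK)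
    obtain ⟨B, hB, hHB⟩ := H.exists_finite_inf_mul_eq N
    refine ⟨Set.image2 (fun b t =>
      ((H ⊓ N) :: t.1.map (fun K => K.map (MulAut.conj b).toMonoidHom), b * t.2)) B T,
      hB.image2 _ hT, ?_, ?_⟩
    · rintro _ ⟨b, -, t, ht, rfl⟩
      obtain ⟨hlen, hsub⟩ := hT' t ht
      refine ⟨by simp [hlen], ?_⟩
      intro K hK
      rcases List.mem_cons.1 hK with rfl | hK
      · exact ⟨(hL H List.mem_cons_self).inf_of_finiteIndex N, inf_le_right⟩
      · obtain ⟨K, hKt, rfl⟩ := List.mem_map.1 hK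
        refine ⟨(hsub K hKt).1.map_monoidHom _, ?_⟩
        rintro _ ⟨x, hx, rfl⟩
        exact Subgroup.Normal.conj_mem inferInstance x ((hsub K hKt).2 hx) b
    · rw [subgroupListProd_cons, hprod, hHB, Set.biUnion_image2, ← Set.biUnion_of_singleton B]
      simp only [Set.mul_iUnion, Set.iUnion_mul, Set.mem_iUnion, Set.mem_singleton_iff,
        exists_prop, exists_eq_right']
      rw [Set.iUnion₂_comm]
      refine Set.iUnion₂_congr fun b _ => Set.iUnion₂_congr fun t _ => ?_
      rw [subgroupListProd_cons, ← image_subgroupListProd, mul_assoc, ← mul_assoc ({b} : Set G),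
        singleton_mul_eq_image_conj_mul_singleton, mul_assoc, Set.singleton_mul_singleton,
        ← mul_assoc]

end FiniteGeneration

section Separability

variable {G P : Type*} [Group G] [Group P]

theorem SepSubset.union {Y Z : Set G} (hY : SepSubset Y) (hZ : SepSubset Z) :
    SepSubset (Y ∪ Z) := by
  intro g hg
  rw [Set.mem_union, not_or] at hg
  obtain ⟨M, hM, hM', hgM⟩ := hY g hg.1
  obtain ⟨N, hN, hN', hgN⟩ := hZ g hg.2
  refine ⟨M ⊓ N, inferInstance, inferInstance, ?_⟩
  rw [Set.union_mul]
  rintro (h | h)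
  · exact hgM (Set.mul_subset_mul_left (fun x hx => hx.1) h)
  · exact hgN (Set.mul_subset_mul_left (fun x hx => hx.2) h)

theorem SepSubset.biUnion {ι : Type*} {T : Set ι} (hT : T.Finite) {Z : ι → Set G}
    (hZ : ∀ t ∈ T, SepSubset (Z t)) : SepSubset (⋃ t ∈ T, Z t) := by
  induction T, hT using Set.Finite.induction_on with
  | empty => exact fun g _ => ⟨⊤, inferInstance, inferInstance, by simp⟩
  | insert _ _ ih =>
    rw [Set.biUnion_insert]
    exact (hZ _ (Set.mem_insert _ _)).union (ih fun t ht => hZ t (Set.mem_insert_of_mem _ ht))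

theorem SepSubset.singleton_mul_mul_singleton {Z : Set G} (hZ : SepSubset Z) (a b : G) :
    SepSubset ({a} * Z * {b}) := by
  intro g hg
  obtain ⟨N, hN, hN', hgN⟩ := hZ (a⁻¹ * g * b⁻¹) fun h => hg <| by
    rw [Set.mul_singleton, Set.singleton_mul]
    exact ⟨_, ⟨_, h, rfl⟩, by simp [mul_assoc]⟩
  refine ⟨N, hN, hN', fun h => hgN ?_⟩
  rw [mul_assoc, Subgroup.set_mul_normal_comm, ← mul_assoc, mul_assoc {a} Z] at h
  rw [Set.mul_singleton, Set.singleton_mul] at h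
  obtain ⟨_, ⟨x, hx, rfl⟩, rfl⟩ := h
  simpa [mul_assoc] using hx

theorem SepSubset.preimage {Z : Set P} (hZ : SepSubset Z) (f : G →* P) :
    SepSubset (f ⁻¹' Z) := by
  intro g hg
  obtain ⟨N, hN, hN', hgN⟩ := hZ (f g) hg
  refine ⟨N.comap f, inferInstance, ⟨?_⟩, ?_⟩
  · rw [Subgroup.index_comap]
    exact (Subgroup.isFiniteRelIndex_of_finiteIndex (H := N) (K := f.range)).relIndex_ne_zero
  · rintro ⟨z, hz, x, hx, rfl⟩
    exact hgN ⟨f z, hz, f x, hx, (map_mul f z x).symm⟩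

theorem SepSubset.image_subtype {K : Subgroup G} [K.FiniteIndex] {Z : Set K}
    (hZ : SepSubset Z) : SepSubset (K.subtype '' Z) := by
  intro g hg
  by_cases hgK : g ∈ K
  · obtain ⟨N, hN, hN', hgN⟩ := hZ ⟨g, hgK⟩ fun h => hg ⟨_, h, rfl⟩
    have : (N.map K.subtype).FiniteIndex := ⟨by
      rw [Subgroup.index_map_subtype]
      exact mul_ne_zero hN'.index_ne_zero Subgroup.FiniteIndex.index_ne_zero⟩
    refine ⟨(N.map K.subtype).normalCore, inferInstance, inferInstance, ?_⟩
    rintro ⟨_, ⟨z, hz, rfl⟩, x, hx, hzx⟩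
    obtain ⟨y, hy, rfl⟩ := Subgroup.normalCore_le _ hx
    exact hgN ⟨z, hz, y, hy, Subtype.ext hzx⟩
  · refine ⟨K.normalCore, inferInstance, inferInstance, ?_⟩
    rintro ⟨_, ⟨z, hz, rfl⟩, x, hx, rfl⟩
    exact hgK (K.mul_mem z.2 (K.normalCore_le hx))

theorem HasRZ.sepSubset_subgroupListProd {L : List (Subgroup P)} (h : HasRZ P L.length)
    (hL : ∀ H ∈ L, H.FG) : SepSubset (subgroupListProd L) := by
  have := h L.get fun i => hL _ (L.get_mem i)
  rwa [← Function.comp_def, ← List.map_ofFn, List.ofFn_get] at this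

/-- If `G ⧸ K` has `RZ_s`, then products of `s + 1` subgroups of `G`, one of which is `K` and
the others are finitely generated, are separable. -/
theorem HasRZ.sepSubset_mul_normal_mul {K : Subgroup G} [K.Normal] {L M : List (Subgroup G)}
    (h : HasRZ (G ⧸ K) (L.length + M.length)) (hL : ∀ H ∈ L, H.FG) (hM : ∀ H ∈ M, H.FG) :
    SepSubset (subgroupListProd L * (K : Set G) * subgroupListProd M) := by
  have hsep : SepSubset
      (subgroupListProd ((L ++ M).map fun H => H.map (QuotientGroup.mk' K))) := by
    refine HasRZ.sepSubset_subgroupListProd (by simpa using h) ?_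
    intro H hH
    obtain ⟨H, hHLM, rfl⟩ := List.mem_map.1 hH
    exact ((List.mem_append.1 hHLM).elim (hL H) (hM H)).map_monoidHom _
  have hpre := hsep.preimage (QuotientGroup.mk' K)
  rw [← image_subgroupListProd, QuotientGroup.coe_mk',
    QuotientGroup.preimage_image_mk_eq_mul, subgroupListProd_append, mul_assoc,
    Subgroup.set_mul_normal_comm, ← mul_assoc] at hpre
  exact hpre

theorem image_subtype_subgroupListProd_map_subgroupOf {K : Subgroup G} {L : List (Subgroup G)}
    (hL : ∀ H ∈ L, H ≤ K) :
    K.subtype '' subgroupListProd (L.map fun H => H.subgroupOf K) = subgroupListProd L := by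
  rw [image_subgroupListProd, List.map_map]
  congr 1
  refine (List.map_congr_left fun H hH => ?_).trans (List.map_id L)
  simp [Subgroup.subgroupOf_map_subtype, hL H hH]

end Separability

/-- Lemma 14.3: if `F_1, …, F_n ≤ G` are finitely generated, `G' ≤_f G`,
`F_i' = F_i ⊓ G'` is normal in `G'` and `G'/F_i'` has property `RZ_{n-1}`, then the
product `F_1 ⋯ F_n` is separable in `G`. -/
theorem stmt_18 {G : Type*} [Group G] (n : ℕ) (hn : 2 ≤ n) (F : Fin n → Subgroup G)
    (hFG : ∀ i, (F i).FG) (G' : Subgroup G) (hG' : G'.FiniteIndex) (i : Fin n)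
    [hnorm : ((F i ⊓ G').subgroupOf G').Normal]
    (hRZ : HasRZ (↥G' ⧸ (F i ⊓ G').subgroupOf G') (n - 1)) :
    SepSubset (((List.finRange n).map (fun j => ((F j : Subgroup G) : Set G))).prod) := by
  obtain ⟨A, B, hAB⟩ := List.append_of_mem (List.mem_finRange i)
  have hlen : A.length + B.length = n - 1 := by
    have := congrArg List.length hAB
    simp only [List.length_finRange, List.length_append, List.length_cons] at this
    omega
  have hfg : ∀ C : List (Fin n), ∀ H ∈ C.map F, H.FG := by
    intro C H hH
    obtain ⟨j, -, rfl⟩ := List.mem_map.1 hH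
    exact hFG j
  obtain ⟨S, hS, hS', hSA⟩ :=
    exists_finite_biUnion_eq_subgroupListProd G'.normalCore _ (hfg A)
  obtain ⟨T, hT, hT', hTB⟩ :=
    exists_finite_biUnion_eq_subgroupListProd G'.normalCore _ (hfg B)
  obtain ⟨C, hC, hCF⟩ := (F i).exists_finite_mul_inf_eq G'
  have hprod : ((List.finRange n).map (fun j => ((F j : Subgroup G) : Set G))).prod =
      ⋃ s ∈ S, ⋃ c ∈ C, ⋃ t ∈ T, subgroupListProd s.1 * {s.2} *
        ({c} * ((F i ⊓ G' : Subgroup G) : Set G)) * (subgroupListProd t.1 * {t.2}) := by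
    have hsplit : ((List.finRange n).map (fun j => ((F j : Subgroup G) : Set G))).prod =
        subgroupListProd (A.map F) * (F i : Set G) * subgroupListProd (B.map F) := by
      rw [hAB]
      simp [subgroupListProd, Function.comp_def, mul_assoc]
    rw [hsplit, hSA, hTB, hCF]
    ext x
    simp only [Set.mem_iUnion]
    constructor
    · rintro ⟨_, ⟨u, hu, _, ⟨c, hc, v, hv, rfl⟩, rfl⟩, w, hw, rfl⟩
      obtain ⟨s, hs, hu⟩ := Set.mem_iUnion₂.1 hu
      obtain ⟨t, ht, hw⟩ := Set.mem_iUnion₂.1 hw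
      exact ⟨s, hs, c, hc, t, ht,
        Set.mul_mem_mul (Set.mul_mem_mul hu (Set.mul_mem_mul rfl hv)) hw⟩
    · rintro ⟨s, hs, c, hc, t, ht, _, ⟨u, hu, _, ⟨_, rfl, v, hv, rfl⟩, rfl⟩, w, hw, rfl⟩
      exact Set.mul_mem_mul (Set.mul_mem_mul (Set.mem_iUnion₂.2 ⟨s, hs, hu⟩)
        (Set.mul_mem_mul hc hv)) (Set.mem_iUnion₂.2 ⟨t, ht, hw⟩)
  rw [hprod]
  refine SepSubset.biUnion hS fun s hs => SepSubset.biUnion hC fun c _ =>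
    SepSubset.biUnion hT fun t ht => ?_
  obtain ⟨hsl, hsN⟩ := hS' s hs
  obtain ⟨htl, htN⟩ := hT' t ht
  set L := s.1.map fun H => H.map (MulAut.conj (s.2 * c)⁻¹).toMonoidHom with hLdef
  have hL : ∀ H ∈ L, H.FG ∧ H ≤ G' := by
    intro H hH
    obtain ⟨H, hHs, rfl⟩ := List.mem_map.1 hH
    refine ⟨(hsN H hHs).1.map_monoidHom _, ?_⟩
    rintro _ ⟨x, hx, rfl⟩
    exact G'.normalCore_le
      (Subgroup.Normal.conj_mem inferInstance x ((hsN H hHs).2 hx) (s.2 * c)⁻¹)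
  have hM : ∀ H ∈ t.1, H.FG ∧ H ≤ G' := fun H hH =>
    ⟨(htN H hH).1, (htN H hH).2.trans G'.normalCore_le⟩
  have hfg' : ∀ M : List (Subgroup G), (∀ H ∈ M, H.FG ∧ H ≤ G') →
      ∀ H ∈ M.map (fun H => H.subgroupOf G'), H.FG := by
    intro M hM H hH
    obtain ⟨H, hHM, rfl⟩ := List.mem_map.1 hH
    exact (hM H hHM).1.subgroupOf_of_le (hM H hHM).2
  have hsep : SepSubset (subgroupListProd L * ((F i ⊓ G' : Subgroup G) : Set G) *
      subgroupListProd t.1) := by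
    have hRZ' : HasRZ (↥G' ⧸ (F i ⊓ G').subgroupOf G')
        ((L.map fun H => H.subgroupOf G').length +
          (t.1.map fun H => H.subgroupOf G').length) := by
      have hcount : (L.map fun H => H.subgroupOf G').length +
          (t.1.map fun H => H.subgroupOf G').length = n - 1 := by
        simp [hLdef, hsl, htl, hlen]
      rwa [hcount]
    have := (hRZ'.sepSubset_mul_normal_mul (hfg' L hL) (hfg' t.1 hM)).image_subtype
    rw [Set.image_mul, Set.image_mul,
      image_subtype_subgroupListProd_map_subgroupOf fun H hH => (hL H hH).2,
      image_subtype_subgroupListProd_map_subgroupOf fun H hH => (hM H hH).2,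
      ← Subgroup.coe_map, Subgroup.subgroupOf_map_subtype, inf_eq_left.2 inf_le_right] at this
    exact this
  have htranslate := hsep.singleton_mul_mul_singleton (s.2 * c) t.2
  rw [hLdef, ← image_subgroupListProd, ← mul_assoc, ← mul_assoc,
    ← mul_singleton_eq_singleton_mul_image_conj, ← Set.singleton_mul_singleton] at htranslate
  simpa only [mul_assoc] using htranslate
end
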